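/- Let f : ℝ → ℝ be a C³ function, bounded together with its first three derivatives, and let u : ℝ×ℝ → ℝ be a smooth classical solution of the mKdV equation u_t + (u_{xx} + u³)_x = 0 such that for each t, u(t,·) together with its x-derivatives up to order four is Schwartz (rapidly decaying). Then for all t, (d/dt)∫ [(1/2)·u_{xx}² − (5/2)·u²·u_x² + (1/4)·u⁶]·f(x) dx = ∫ (−(3/2)·u_{xxx}² + 9·u_{xx}²·u² + 15·u_x²·u·u_{xx} + (9/16)·u⁸ + (1/4)·u_x⁴ + (3/2)·u_{xx}·u⁵ − (45/4)·u⁴·u_x²)·f'(x) dx + 5∫ u²·u_x·u_{xx}·f''(x) dx + (1/2)∫ u_{xx}²·f'''(x) dx. -/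

import Mathlib

open Real MeasureTheory
open Filter Topology

/-- A function `φ 0` of class `C³` together with its first three derivatives `φ 1`, `φ 2`, `φ 3`. -/
structure DerivTower (φ : ℕ → ℝ → ℝ) : Prop where
  hasDerivAt : ∀ k < 3, ∀ x, HasDerivAt (φ k) (φ (k + 1) x) x
  continuous : ∀ k ≤ 3, Continuous (φ k)

lemma DerivTower.hasCompactSupport {φ : ℕ → ℝ → ℝ} (h : DerivTower φ)
    (h0 : HasCompactSupport (φ 0)) : ∀ k ≤ 3, HasCompactSupport (φ k) := by
  intro k
  induction k with
  | zero => exact fun _ => h0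
  | succ k ih =>
    intro hk
    have := (ih (by omega)).deriv
    rwa [show deriv (φ k) = φ (k + 1) from
      funext fun x => (h.hasDerivAt k (by omega) x).deriv] at this

/-- The tower of derivatives of a product. -/
def towerMul (φ ψ : ℕ → ℝ → ℝ) : ℕ → ℝ → ℝ
  | 0, x => φ 0 x * ψ 0 x
  | 1, x => φ 1 x * ψ 0 x + φ 0 x * ψ 1 x
  | 2, x => φ 2 x * ψ 0 x + 2 * (φ 1 x * ψ 1 x) + φ 0 x * ψ 2 x
  | _, x => φ 3 x * ψ 0 x + 3 * (φ 2 x * ψ 1 x) + 3 * (φ 1 x * ψ 2 x) + φ 0 x * ψ 3 x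

lemma DerivTower.mul {φ ψ : ℕ → ℝ → ℝ} (hφ : DerivTower φ) (hψ : DerivTower ψ) :
    DerivTower (towerMul φ ψ) where
  hasDerivAt := by
    have a0 := hφ.hasDerivAt 0 (by norm_num)
    have a1 := hφ.hasDerivAt 1 (by norm_num)
    have a2 := hφ.hasDerivAt 2 (by norm_num)
    have b0 := hψ.hasDerivAt 0 (by norm_num)
    have b1 := hψ.hasDerivAt 1 (by norm_num)
    have b2 := hψ.hasDerivAt 2 (by norm_num)
    intro k hk x
    interval_cases k
    · exact (a0 x).mul (b0 x)
    · refine (((a1 x).mul (b0 x)).add ((a0 x).mul (b1 x))).congr_deriv ?_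
      simp only [towerMul]; ring
    · refine ((((a2 x).mul (b0 x)).add (((a1 x).mul (b1 x)).const_mul 2)).add
        ((a0 x).mul (b2 x))).congr_deriv ?_
      simp only [towerMul]; ring
  continuous := by
    have a0 := hφ.continuous 0 (by norm_num)
    have a1 := hφ.continuous 1 (by norm_num)
    have a2 := hφ.continuous 2 (by norm_num)
    have a3 := hφ.continuous 3 (by norm_num)
    have b0 := hψ.continuous 0 (by norm_num)
    have b1 := hψ.continuous 1 (by norm_num)
    have b2 := hψ.continuous 2 (by norm_num)
    have b3 := hψ.continuous 3 (by norm_num)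
    intro k hk
    interval_cases k <;> · unfold towerMul; fun_prop

lemma derivTower_iteratedDeriv {f : ℝ → ℝ} (hf : ContDiff ℝ 3 f) :
    DerivTower (fun k => iteratedDeriv k f) where
  hasDerivAt := by
    intro k hk x
    have h := (hf.differentiable_iteratedDeriv k (by exact_mod_cast hk)) x
    simpa [iteratedDeriv_succ] using h.hasDerivAt
  continuous := by
    intro k hk
    exact hf.continuous_iteratedDeriv k (by exact_mod_cast hk)

lemma exists_cutoff : ∃ (χ : ℕ → ℕ → ℝ → ℝ) (K : ℝ), 0 ≤ K ∧ (∀ n, DerivTower (χ n)) ∧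
    (∀ n, HasCompactSupport (χ n 0)) ∧ (∀ n x, |χ n 0 x| ≤ 1) ∧
    (∀ x, ∀ᶠ n in atTop, χ n 0 x = 1) ∧
    ∀ n x k, 1 ≤ k → k ≤ 3 → |χ n k x| ≤ K / (n + 1) := by
  obtain ⟨ρ⟩ : Nonempty (ContDiffBump (0 : ℝ)) := ⟨⟨1, 2, by norm_num, by norm_num⟩⟩
  have hρ : ContDiff ℝ 3 (ρ : ℝ → ℝ) := ρ.contDiff
  have hT := derivTower_iteratedDeriv hρ
  have hsupp := hT.hasCompactSupport (by simpa using ρ.hasCompactSupport)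
  have hb : ∀ k ≤ 3, ∃ C, ∀ x, |iteratedDeriv k (ρ : ℝ → ℝ) x| ≤ C := fun k hk => by
    obtain ⟨C, hC⟩ := (hT.continuous k hk).bounded_above_of_compact_support (hsupp k hk)
    exact ⟨C, by simpa [Real.norm_eq_abs] using hC⟩
  choose! C hC using hb
  have hC0 : ∀ k ≤ 3, 0 ≤ C k := fun k hk => (abs_nonneg _).trans (hC k hk 0)
  have hpos : ∀ n : ℕ, (0 : ℝ) < 1 / ((n : ℝ) + 1) := fun n => by positivity
  refine ⟨fun n k x => (1 / ((n : ℝ) + 1)) ^ k * iteratedDeriv k (ρ : ℝ → ℝ)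
    (1 / ((n : ℝ) + 1) * x), C 1 + C 2 + C 3, ?_, ?_, ?_, ?_, ?_, ?_⟩
  · linarith [hC0 1 (by norm_num), hC0 2 (by norm_num), hC0 3 (by norm_num)]
  · intro n
    refine ⟨fun k hk x => ?_, fun k hk => ?_⟩
    · have h1 := hT.hasDerivAt k hk (1 / ((n : ℝ) + 1) * x)
      have h2 := (h1.comp x ((hasDerivAt_id x).const_mul (1 / ((n : ℝ) + 1)))).const_mul
        ((1 / ((n : ℝ) + 1)) ^ k)
      refine h2.congr_deriv ?_
      ring
    · have := hT.continuous k hk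
      exact continuous_const.mul (this.comp (continuous_const.mul continuous_id))
  · intro n
    simp only [pow_zero, one_mul]
    exact (hsupp 0 (by norm_num)).comp_homeomorph (Homeomorph.mulLeft₀ _ (hpos n).ne')
  · intro n x
    simp only [pow_zero, one_mul, iteratedDeriv_zero]
    rw [abs_of_nonneg ρ.nonneg]
    exact ρ.le_one
  · intro x
    obtain ⟨N, hN⟩ := exists_nat_ge (|x| / ρ.rIn)
    filter_upwards [eventually_ge_atTop N] with n hn
    simp only [pow_zero, one_mul, iteratedDeriv_zero]
    apply ρ.one_of_mem_closedBall
    rw [mem_closedBall_zero_iff, Real.norm_eq_abs, abs_mul, abs_of_pos (hpos n), one_div,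
      inv_mul_le_iff₀ (by positivity)]
    rw [div_le_iff₀ ρ.rIn_pos] at hN
    have : (N : ℝ) ≤ n := by exact_mod_cast hn
    nlinarith [ρ.rIn_pos]
  · intro n x k h1 h3
    have hn := hpos n
    have hn1 : 1 / ((n : ℝ) + 1) ≤ 1 := by
      rw [div_le_one (by positivity)]; linarith [(Nat.cast_nonneg n : (0 : ℝ) ≤ n)]
    have hk : C k ≤ C 1 + C 2 + C 3 := by
      have := hC0 1 (by norm_num); have := hC0 2 (by norm_num); have := hC0 3 (by norm_num)
      interval_cases k <;> linarith
    rw [abs_mul, abs_pow, abs_of_pos hn, div_eq_mul_one_div (C 1 + C 2 + C 3), mul_comm]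
    have hp : (1 / ((n : ℝ) + 1)) ^ k ≤ 1 / ((n : ℝ) + 1) := by
      calc (1 / ((n : ℝ) + 1)) ^ k ≤ (1 / ((n : ℝ) + 1)) ^ 1 :=
            pow_le_pow_of_le_one hn.le hn1 h1
        _ = _ := pow_one _
    exact mul_le_mul ((hC k h3 _).trans hk) hp (by positivity)
      ((abs_nonneg _).trans ((hC k h3 0).trans hk))

/-- The localized balance law `∂ₜ ∫ e φ = ∫ (g φ + p φ' + q φ'' + r φ''')` for compactly supported
test functions `φ` of class `C³`. -/
def BalanceLaw (e g p q r : ℝ → ℝ → ℝ) : Prop :=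
  ∀ φ : ℕ → ℝ → ℝ, DerivTower φ → HasCompactSupport (φ 0) → ∀ t,
    HasDerivAt (fun s => ∫ x, e s x * φ 0 x)
      (∫ x, (g t x * φ 0 x + p t x * φ 1 x + q t x * φ 2 x + r t x * φ 3 x)) t

lemma integral_mul_deriv_of_hasCompactSupport {F F' ψ ψ' : ℝ → ℝ}
    (hF : ∀ x, HasDerivAt F (F' x) x) (hψ : ∀ x, HasDerivAt ψ (ψ' x) x)
    (hF' : Continuous F') (hψ' : Continuous ψ') (hs : HasCompactSupport ψ) :
    ∫ x, F x * ψ' x = -∫ x, F' x * ψ x := by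
  have cF : Continuous F := continuous_iff_continuousAt.2 fun x => (hF x).continuousAt
  have cψ : Continuous ψ := continuous_iff_continuousAt.2 fun x => (hψ x).continuousAt
  have hs' : HasCompactSupport ψ' := by
    have := hs.deriv
    rwa [show deriv ψ = ψ' from funext fun x => (hψ x).deriv] at this
  exact integral_mul_deriv_eq_deriv_mul_of_integrable (fun x _ => hF x) (fun x _ => hψ x)
    ((cF.mul hψ').integrable_of_hasCompactSupport hs'.mul_left)
    ((hF'.mul cψ).integrable_of_hasCompactSupport hs.mul_left)
    ((cF.mul cψ).integrable_of_hasCompactSupport hs.mul_left)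

lemma hasDerivAt_integral_mul_of_hasCompactSupport {e e' : ℝ → ℝ → ℝ} {φ : ℝ → ℝ}
    (he : ∀ t, Continuous (e t)) (he' : Continuous fun z : ℝ × ℝ => e' z.1 z.2)
    (hd : ∀ t x, HasDerivAt (fun s => e s x) (e' t x) t)
    (hφ : Continuous φ) (hs : HasCompactSupport φ) (t : ℝ) :
    HasDerivAt (fun s => ∫ x, e s x * φ x) (∫ x, e' t x * φ x) t := by
  obtain ⟨C, hC⟩ := ((isCompact_closedBall t 1).prod hs.isCompact).exists_bound_of_continuousOn
    (f := fun z : ℝ × ℝ => e' z.1 z.2) he'.continuousOn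
  have hC' : ∀ᵐ x, ∀ s ∈ Metric.ball t 1, ‖e' s x * φ x‖ ≤ C * ‖φ x‖ := by
    refine ae_of_all _ fun x s hsm => ?_
    by_cases hx : x ∈ tsupport φ
    · rw [norm_mul]
      exact mul_le_mul_of_nonneg_right
        (hC (s, x) ⟨Metric.ball_subset_closedBall hsm, hx⟩) (norm_nonneg _)
    · simp [image_eq_zero_of_notMem_tsupport hx]
  refine (hasDerivAt_integral_of_dominated_loc_of_deriv_le (Metric.ball_mem_nhds t one_pos)
    (F := fun s x => e s x * φ x) (F' := fun s x => e' s x * φ x)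
    (bound := fun x => C * ‖φ x‖) ?_ ?_ ?_ hC' ?_ ?_).2
  · exact Eventually.of_forall fun s => ((he s).mul hφ).aestronglyMeasurable
  · exact ((he t).mul hφ).integrable_of_hasCompactSupport hs.mul_left
  · have : Continuous (e' t) := he'.comp (by fun_prop : Continuous fun x : ℝ => (t, x))
    exact (this.mul hφ).aestronglyMeasurable
  · exact (hφ.norm.integrable_of_hasCompactSupport hs.norm).const_mul C
  · exact ae_of_all _ fun x s _ => (hd s x).mul_const _

lemma balanceLaw_of_hasDerivAt {e e' g p p₁ q q₁ q₂ r r₁ r₂ r₃ : ℝ → ℝ → ℝ}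
    (he : ∀ t, Continuous (e t)) (he' : Continuous fun z : ℝ × ℝ => e' z.1 z.2)
    (hd : ∀ t x, HasDerivAt (fun s => e s x) (e' t x) t)
    (hg : ∀ t, Continuous (g t))
    (hp : ∀ t x, HasDerivAt (p t) (p₁ t x) x) (hp₁ : ∀ t, Continuous (p₁ t))
    (hq : ∀ t x, HasDerivAt (q t) (q₁ t x) x) (hq₁ : ∀ t x, HasDerivAt (q₁ t) (q₂ t x) x)
    (hq₂ : ∀ t, Continuous (q₂ t))
    (hr : ∀ t x, HasDerivAt (r t) (r₁ t x) x) (hr₁ : ∀ t x, HasDerivAt (r₁ t) (r₂ t x) x)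
    (hr₂ : ∀ t x, HasDerivAt (r₂ t) (r₃ t x) x) (hr₃ : ∀ t, Continuous (r₃ t))
    (h : ∀ t x, e' t x = g t x - p₁ t x + q₂ t x - r₃ t x) :
    BalanceLaw e g p q r := by
  intro φ hφ hs t
  have hsk := hφ.hasCompactSupport hs
  have d0 := hφ.hasDerivAt 0 (by norm_num)
  have d1 := hφ.hasDerivAt 1 (by norm_num)
  have d2 := hφ.hasDerivAt 2 (by norm_num)
  have c0 := hφ.continuous 0 (by norm_num)
  have c1 := hφ.continuous 1 (by norm_num)
  have c2 := hφ.continuous 2 (by norm_num)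
  have c3 := hφ.continuous 3 (by norm_num)
  have s1 := hsk 1 (by norm_num)
  have s2 := hsk 2 (by norm_num)
  have s3 := hsk 3 (by norm_num)
  have cont : ∀ {F F' : ℝ → ℝ}, (∀ x, HasDerivAt F (F' x) x) → Continuous F := fun hF =>
    continuous_iff_continuousAt.2 fun x => (hF x).continuousAt
  have int : ∀ {F ψ : ℝ → ℝ}, Continuous F → Continuous ψ → HasCompactSupport ψ →
      Integrable fun x => F x * ψ x := fun hF hψ hsψ =>
    (hF.mul hψ).integrable_of_hasCompactSupport hsψ.mul_left
  refine (hasDerivAt_integral_mul_of_hasCompactSupport he he' hd c0 hs t).congr_deriv ?_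
  have ep := integral_mul_deriv_of_hasCompactSupport (hp t) d0 (hp₁ t) c1 hs
  have eq1 := integral_mul_deriv_of_hasCompactSupport (hq t) d1 (cont (hq₁ t)) c2 s1
  have eq2 := integral_mul_deriv_of_hasCompactSupport (hq₁ t) d0 (hq₂ t) c1 hs
  have er1 := integral_mul_deriv_of_hasCompactSupport (hr t) d2 (cont (hr₁ t)) c3 s2
  have er2 := integral_mul_deriv_of_hasCompactSupport (hr₁ t) d1 (cont (hr₂ t)) c2 s1
  have er3 := integral_mul_deriv_of_hasCompactSupport (hr₂ t) d0 (hr₃ t) c1 hs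
  have i0 := int (hg t) c0 hs
  have i1 := int (cont (hp t)) c1 s1
  have i2 := int (cont (hq t)) c2 s2
  have i3 := int (cont (hr t)) c3 s3
  have j1 := int (hp₁ t) c0 hs
  have j2 := int (hq₂ t) c0 hs
  have j3 := int (hr₃ t) c0 hs
  have k1 : Integrable fun x => g t x * φ 0 x + p t x * φ 1 x := i0.add i1
  have k2 : Integrable fun x => g t x * φ 0 x + p t x * φ 1 x + q t x * φ 2 x := k1.add i2
  have l1 : Integrable fun x => g t x * φ 0 x - p₁ t x * φ 0 x := i0.sub j1
  have l2 : Integrable fun x => g t x * φ 0 x - p₁ t x * φ 0 x + q₂ t x * φ 0 x := l1.add j2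
  rw [integral_add k2 i3, integral_add k1 i2, integral_add i0 i1]
  simp only [zero_add, Nat.reduceAdd] at ep eq1 eq2 er1 er2 er3
  rw [ep, eq1, eq2, er1, er2, er3]
  simp only [h, sub_mul, add_mul]
  rw [integral_sub l2 j3, integral_add l1 j2, integral_sub i0 j1]
  ring

lemma integrable_mul_of_abs_le {F ψ : ℝ → ℝ} {M : ℝ} (hF : Integrable F) (hψ : Continuous ψ)
    (hM : ∀ x, |ψ x| ≤ M) : Integrable fun x => F x * ψ x :=
  hF.mul_bdd hψ.aestronglyMeasurable (ae_of_all _ hM)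

lemma abs_integral_mul_le {F ψ : ℝ → ℝ} {M : ℝ} (hF : Integrable F) (hM : ∀ x, |ψ x| ≤ M) :
    |∫ x, F x * ψ x| ≤ M * ∫ x, |F x| := by
  rw [← integral_const_mul, ← Real.norm_eq_abs]
  refine norm_integral_le_of_norm_le (hF.abs.const_mul M) (ae_of_all _ fun x => ?_)
  rw [norm_mul, Real.norm_eq_abs, Real.norm_eq_abs, mul_comm]
  exact mul_le_mul_of_nonneg_right (hM x) (abs_nonneg _)

lemma tendsto_integral_mul {F ψ : ℝ → ℝ} {ψn : ℕ → ℝ → ℝ} {M : ℝ} (hF : Integrable F)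
    (hc : ∀ n, Continuous (ψn n)) (hM : ∀ n x, |ψn n x| ≤ M)
    (h : ∀ x, Tendsto (fun n => ψn n x) atTop (𝓝 (ψ x))) :
    Tendsto (fun n => ∫ x, F x * ψn n x) atTop (𝓝 (∫ x, F x * ψ x)) := by
  refine tendsto_integral_of_dominated_convergence (fun x => M * |F x|)
    (fun n => hF.aestronglyMeasurable.mul (hc n).aestronglyMeasurable) (hF.abs.const_mul M)
    (fun n => ae_of_all _ fun x => ?_) (ae_of_all _ fun x => (h x).const_mul _)
  rw [norm_mul, Real.norm_eq_abs, Real.norm_eq_abs, mul_comm]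
  exact mul_le_mul_of_nonneg_right (hM n x) (abs_nonneg _)

lemma BalanceLaw.abs_integral_sub_le {e g p q r : ℝ → ℝ → ℝ} (h : BalanceLaw e g p q r)
    (he : ∀ τ, Integrable (e τ)) (hg : ∀ τ, Integrable (g τ)) (hp : ∀ τ, Integrable (p τ))
    (hq : ∀ τ, Integrable (q τ)) (hr : ∀ τ, Integrable (r τ))
    {J : Set ℝ} (hJ : Convex ℝ J) {Γ B : ℝ}
    (hΓ : ∀ τ ∈ J, ∫ x, |g τ x| ≤ Γ) (hpB : ∀ τ ∈ J, ∫ x, |p τ x| ≤ B)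
    (hqB : ∀ τ ∈ J, ∫ x, |q τ x| ≤ B) (hrB : ∀ τ ∈ J, ∫ x, |r τ x| ≤ B)
    {τ₁ τ₂ : ℝ} (h₁ : τ₁ ∈ J) (h₂ : τ₂ ∈ J) :
    |(∫ x, e τ₁ x) - ∫ x, e τ₂ x| ≤ Γ * |τ₁ - τ₂| := by
  obtain ⟨χ, K, hK, hT, hs, h1, hlim, hb⟩ := exists_cutoff
  have key : ∀ n : ℕ, |(∫ x, e τ₁ x * χ n 0 x) - ∫ x, e τ₂ x * χ n 0 x| ≤
      (Γ + 3 * (K / (n + 1) * B)) * |τ₁ - τ₂| := by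
    intro n
    have hKn : 0 ≤ K / ((n : ℝ) + 1) := by positivity
    refine hJ.norm_image_sub_le_of_norm_hasDerivWithin_le
      (f := fun s => ∫ x, e s x * χ n 0 x)
      (fun s _ => (h (χ n) (hT n) (hs n) s).hasDerivWithinAt) (fun s hsJ => ?_) h₂ h₁
    have c := (hT n).continuous
    have i0 := integrable_mul_of_abs_le (hg s) (c 0 (by norm_num)) (h1 n)
    have i1 := integrable_mul_of_abs_le (hp s) (c 1 (by norm_num))
      fun x => hb n x 1 (by norm_num) (by norm_num)
    have i2 := integrable_mul_of_abs_le (hq s) (c 2 (by norm_num))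
      fun x => hb n x 2 (by norm_num) (by norm_num)
    have i3 := integrable_mul_of_abs_le (hr s) (c 3 (by norm_num))
      fun x => hb n x 3 (by norm_num) (by norm_num)
    have a0 := abs_integral_mul_le (hg s) (h1 n)
    have a1 := abs_integral_mul_le (hp s) fun x => hb n x 1 (by norm_num) (by norm_num)
    have a2 := abs_integral_mul_le (hq s) fun x => hb n x 2 (by norm_num) (by norm_num)
    have a3 := abs_integral_mul_le (hr s) fun x => hb n x 3 (by norm_num) (by norm_num)
    have k1 : Integrable fun x => g s x * χ n 0 x + p s x * χ n 1 x := i0.add i1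
    have k2 : Integrable fun x => g s x * χ n 0 x + p s x * χ n 1 x + q s x * χ n 2 x := k1.add i2
    rw [integral_add k2 i3, integral_add k1 i2, integral_add i0 i1, Real.norm_eq_abs]
    have b1 := mul_le_mul_of_nonneg_left (hpB s hsJ) hKn
    have b2 := mul_le_mul_of_nonneg_left (hqB s hsJ) hKn
    have b3 := mul_le_mul_of_nonneg_left (hrB s hsJ) hKn
    have b0 := hΓ s hsJ
    refine (abs_add_le _ _).trans ?_
    refine (add_le_add_left
      ((abs_add_le _ _).trans (add_le_add_left (abs_add_le _ _) _)) _).trans ?_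
    linarith
  have hl : ∀ τ, Tendsto (fun n => ∫ x, e τ x * χ n 0 x) atTop (𝓝 (∫ x, e τ x)) := fun τ => by
    have := tendsto_integral_mul (ψ := fun _ => 1) (he τ)
      (fun n => (hT n).continuous 0 (by norm_num)) h1
      (fun x => tendsto_const_nhds.congr' ((hlim x).mono fun n hn => hn.symm))
    simpa using this
  have hK0 : Tendsto (fun n : ℕ => K / ((n : ℝ) + 1)) atTop (𝓝 0) :=
    tendsto_const_nhds.div_atTop (tendsto_natCast_atTop_atTop.atTop_add tendsto_const_nhds)
  have hr' : Tendsto (fun n : ℕ => (Γ + 3 * (K / ((n : ℝ) + 1) * B)) * |τ₁ - τ₂|) atTop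
      (𝓝 (Γ * |τ₁ - τ₂|)) := by
    have := (((hK0.mul_const B).const_mul 3).const_add Γ).mul_const |τ₁ - τ₂|
    simpa using this
  exact le_of_tendsto_of_tendsto' ((hl τ₁).sub (hl τ₂)).abs hr' key

lemma BalanceLaw.hasDerivAt_integral {e p q r : ℝ → ℝ → ℝ}
    (h : BalanceLaw e (fun _ _ => 0) p q r)
    (he : ∀ τ, Integrable (e τ)) (hp : ∀ τ, Integrable (p τ))
    (hq : ∀ τ, Integrable (q τ)) (hr : ∀ τ, Integrable (r τ))
    {f : ℕ → ℝ → ℝ} (hf : DerivTower f) {M : ℝ} (hM : ∀ k ≤ 3, ∀ x, |f k x| ≤ M) {t : ℝ}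
    (hpt : Tendsto (fun τ => ∫ x, |p τ x - p t x|) (𝓝 t) (𝓝 0))
    (hqt : Tendsto (fun τ => ∫ x, |q τ x - q t x|) (𝓝 t) (𝓝 0))
    (hrt : Tendsto (fun τ => ∫ x, |r τ x - r t x|) (𝓝 t) (𝓝 0)) :
    HasDerivAt (fun s => ∫ x, e s x * f 0 x)
      ((∫ x, p t x * f 1 x) + (∫ x, q t x * f 2 x) + ∫ x, r t x * f 3 x) t := by
  obtain ⟨χ, K, hK, hT, hs, h1, hlim, hb⟩ := exists_cutoff
  have hM0 : 0 ≤ M := (abs_nonneg _).trans (hM 0 (by norm_num) 0)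
  set φ : ℕ → ℕ → ℝ → ℝ := fun n => towerMul f (χ n) with hφ
  have hφT : ∀ n, DerivTower (φ n) := fun n => hf.mul (hT n)
  have hφs : ∀ n, HasCompactSupport (φ n 0) := fun n => by
    change HasCompactSupport fun x => f 0 x * χ n 0 x
    exact (hs n).mul_left
  set L := M * (8 * (K + 1)) with hL
  have hχK : ∀ n k x, k ≤ 3 → |χ n k x| ≤ K + 1 := fun n k x hk => by
    rcases Nat.eq_zero_or_pos k with rfl | hk0
    · linarith [h1 n x]
    · have := hb n x k hk0 hk
      have h2 : K / ((n : ℝ) + 1) ≤ K :=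
        div_le_self hK (by linarith [(Nat.cast_nonneg n : (0 : ℝ) ≤ n)])
      linarith
  have hφL : ∀ n, ∀ k ≤ 3, ∀ x, |φ n k x| ≤ L := by
    intro n k hk x
    have hm : ∀ i j, i ≤ 3 → j ≤ 3 → |f i x * χ n j x| ≤ M * (K + 1) := fun i j hi hj => by
      rw [abs_mul]
      exact mul_le_mul (hM i hi x) (hχK n j x hj) (abs_nonneg _) hM0
    have hMK : 0 ≤ M * (K + 1) := by positivity
    have hab := fun i j hi hj => abs_le.1 (hm i j hi hj)
    rw [abs_le, hL]
    interval_cases k <;> simp only [hφ, towerMul]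
    · have := hab 0 0 (by norm_num) (by norm_num)
      constructor <;> linarith
    · have := hab 1 0 (by norm_num) (by norm_num)
      have := hab 0 1 (by norm_num) (by norm_num)
      constructor <;> linarith
    · have := hab 2 0 (by norm_num) (by norm_num)
      have := hab 1 1 (by norm_num) (by norm_num)
      have := hab 0 2 (by norm_num) (by norm_num)
      constructor <;> linarith
    · have := hab 3 0 (by norm_num) (by norm_num)
      have := hab 2 1 (by norm_num) (by norm_num)
      have := hab 1 2 (by norm_num) (by norm_num)
      have := hab 0 3 (by norm_num) (by norm_num)
      constructor <;> linarith
  have hL0 : 0 ≤ L := by positivity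
  have hφlim : ∀ k ≤ 3, ∀ x, Tendsto (fun n => φ n k x) atTop (𝓝 (f k x)) := by
    intro k hk x
    have z0 : Tendsto (fun n => χ n 0 x) atTop (𝓝 1) :=
      tendsto_const_nhds.congr' ((hlim x).mono fun n hn => hn.symm)
    have hK0 : Tendsto (fun n : ℕ => K / ((n : ℝ) + 1)) atTop (𝓝 0) :=
      tendsto_const_nhds.div_atTop (tendsto_natCast_atTop_atTop.atTop_add tendsto_const_nhds)
    have z : ∀ j, 1 ≤ j → j ≤ 3 → Tendsto (fun n => χ n j x) atTop (𝓝 0) := fun j h1 h3 =>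
      squeeze_zero_norm (fun n => hb n x j h1 h3) hK0
    have z1 := z 1 (by norm_num) (by norm_num)
    have z2 := z 2 (by norm_num) (by norm_num)
    have z3 := z 3 (by norm_num) (by norm_num)
    interval_cases k <;> simp only [hφ, towerMul]
    · simpa using z0.const_mul (f 0 x)
    · simpa using (z0.const_mul (f 1 x)).add (z1.const_mul (f 0 x))
    · simpa using ((z0.const_mul (f 2 x)).add ((z1.const_mul (f 1 x)).const_mul 2)).add
        (z2.const_mul (f 0 x))
    · simpa using (((z0.const_mul (f 3 x)).add ((z1.const_mul (f 2 x)).const_mul 3)).add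
        ((z2.const_mul (f 1 x)).const_mul 3)).add (z3.const_mul (f 0 x))
  have hint : ∀ {F : ℝ → ℝ}, Integrable F → ∀ n, ∀ k ≤ 3, Integrable fun x => F x * φ n k x :=
    fun hF n k hk => integrable_mul_of_abs_le hF ((hφT n).continuous k hk) (hφL n k hk)
  have hlimF : ∀ {F : ℝ → ℝ}, Integrable F → ∀ k ≤ 3,
      Tendsto (fun n => ∫ x, F x * φ n k x) atTop (𝓝 (∫ x, F x * f k x)) := fun hF k hk =>
    tendsto_integral_mul hF (fun n => (hφT n).continuous k hk) (fun n => hφL n k hk) (hφlim k hk)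
  set D : ℕ → ℝ → ℝ := fun n τ =>
    (∫ x, p τ x * φ n 1 x) + (∫ x, q τ x * φ n 2 x) + ∫ x, r τ x * φ n 3 x with hD
  have hderiv : ∀ n τ, HasDerivAt (fun s => ∫ x, e s x * φ n 0 x) (D n τ) τ := by
    intro n τ
    refine (h (φ n) (hφT n) (hφs n) τ).congr_deriv ?_
    have i1 := hint (hp τ) n 1 (by norm_num)
    have i2 := hint (hq τ) n 2 (by norm_num)
    have i3 := hint (hr τ) n 3 (by norm_num)
    have k1 : Integrable fun x => p τ x * φ n 1 x + q τ x * φ n 2 x := i1.add i2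
    simp only [zero_mul, zero_add]
    rw [integral_add k1 i3, integral_add i1 i2]
  have hdiff : ∀ {F : ℝ → ℝ → ℝ}, (∀ τ, Integrable (F τ)) → ∀ n, ∀ k ≤ 3, ∀ τ,
      |(∫ x, F τ x * φ n k x) - ∫ x, F t x * φ n k x| ≤ L * ∫ x, |F τ x - F t x| := by
    intro F hF n k hk τ
    rw [← integral_sub (hint (hF τ) n k hk) (hint (hF t) n k hk)]
    simp only [← sub_mul]
    exact abs_integral_mul_le ((hF τ).sub (hF t)) (hφL n k hk)
  rw [hasDerivAt_iff_isLittleO, Asymptotics.isLittleO_iff]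
  intro ε hε
  have hsum : Tendsto (fun τ => L * (∫ x, |p τ x - p t x|) + L * (∫ x, |q τ x - q t x|) +
      L * ∫ x, |r τ x - r t x|) (𝓝 t) (𝓝 0) := by
    simpa using ((hpt.const_mul L).add (hqt.const_mul L)).add (hrt.const_mul L)
  obtain ⟨δ, hδ, hball⟩ := Metric.eventually_nhds_iff_ball.1 (hsum.eventually_lt_const hε)
  filter_upwards [Metric.ball_mem_nhds t hδ] with s hsδ
  have key : ∀ n, |(∫ x, e s x * φ n 0 x) - (∫ x, e t x * φ n 0 x) - (s - t) * D n t| ≤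
      ε * |s - t| := by
    intro n
    have := (convex_ball t δ).norm_image_sub_le_of_norm_hasDerivWithin_le
      (f := fun s => (∫ x, e s x * φ n 0 x) - s * D n t) (f' := fun τ => D n τ - D n t) (C := ε)
      (fun τ _ => ((hderiv n τ).sub ((hasDerivAt_id τ).mul_const (D n t)
        |>.congr_deriv (one_mul _))).hasDerivWithinAt)
      (fun τ hτ => ?_) (Metric.mem_ball_self hδ) hsδ
    · rw [Real.norm_eq_abs, Real.norm_eq_abs] at this
      refine le_of_eq_of_le ?_ this
      congr 1; ring
    · have e1 := abs_le.1 (hdiff hp n 1 (by norm_num) τ)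
      have e2 := abs_le.1 (hdiff hq n 2 (by norm_num) τ)
      have e3 := abs_le.1 (hdiff hr n 3 (by norm_num) τ)
      have e4 := hball τ hτ
      rw [Real.norm_eq_abs, abs_le]
      simp only [hD]
      constructor <;> linarith [e1.1, e2.1, e3.1, e1.2, e2.2, e3.2]
  have hDlim : Tendsto (fun n => D n t) atTop
      (𝓝 ((∫ x, p t x * f 1 x) + (∫ x, q t x * f 2 x) + ∫ x, r t x * f 3 x)) :=
    ((hlimF (hp t) 1 (by norm_num)).add (hlimF (hq t) 2 (by norm_num))).add
      (hlimF (hr t) 3 (by norm_num))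
  have hfin := (((hlimF (he s) 0 (by norm_num)).sub (hlimF (he t) 0 (by norm_num))).sub
    (hDlim.const_mul (s - t))).abs
  exact le_of_tendsto' hfin key

/-- An `L¹` version of the generalized dominated convergence theorem, in which the dominating
functions converge together with their integrals. -/
lemma tendsto_integral_abs_sub_of_dominated {S P : ℝ → ℝ → ℝ} {t C : ℝ} (hC : 0 ≤ C)
    (hS : ∀ τ, Integrable (S τ)) (hS0 : ∀ τ x, 0 ≤ S τ x)
    (hSt : ∀ x, Tendsto (fun τ => S τ x) (𝓝 t) (𝓝 (S t x)))
    (hSint : Tendsto (fun τ => ∫ x, S τ x) (𝓝 t) (𝓝 (∫ x, S t x)))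
    (hP : ∀ τ, Integrable (P τ)) (hPt : ∀ x, Tendsto (fun τ => P τ x) (𝓝 t) (𝓝 (P t x)))
    (hPS : ∀ᶠ τ in 𝓝 t, ∀ x, |P τ x| ≤ C * S τ x) :
    Tendsto (fun τ => ∫ x, |P τ x - P t x|) (𝓝 t) (𝓝 0) := by
  have hPd : ∀ τ, Integrable fun x => |P τ x - P t x| := fun τ => ((hP τ).sub (hP t)).abs
  have hmin : Tendsto (fun τ => ∫ x, min (S τ x) (S t x)) (𝓝 t) (𝓝 (∫ x, S t x)) := by
    refine tendsto_integral_filter_of_dominated_convergence (S t)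
      (Eventually.of_forall fun τ => ((hS τ).inf (hS t)).aestronglyMeasurable)
      (Eventually.of_forall fun τ => ae_of_all _ fun x => ?_) (hS t) (ae_of_all _ fun x => ?_)
    · rw [Real.norm_eq_abs, abs_of_nonneg (le_min (hS0 _ _) (hS0 _ _))]
      exact min_le_right _ _
    · simpa using (hSt x).min (tendsto_const_nhds (x := S t x))
  have hmin' : Tendsto (fun τ => ∫ x, min |P τ x - P t x| (2 * C * S t x)) (𝓝 t)
      (𝓝 (∫ x : ℝ, (0 : ℝ))) := by
    refine tendsto_integral_filter_of_dominated_convergence (fun x => 2 * C * S t x)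
      (Eventually.of_forall fun τ => ((hPd τ).inf ((hS t).const_mul (2 * C))).aestronglyMeasurable)
      (Eventually.of_forall fun τ => ae_of_all _ fun x => ?_) ((hS t).const_mul _)
      (ae_of_all _ fun x => ?_)
    · rw [Real.norm_eq_abs, abs_of_nonneg (le_min (abs_nonneg _)
        (mul_nonneg (by positivity) (hS0 _ _)))]
      exact min_le_right _ _
    · have h1 := ((hPt x).sub_const (P t x)).abs
      have h2 := h1.min (tendsto_const_nhds (x := 2 * C * S t x))
      have h3 : min |P t x - P t x| (2 * C * S t x) = 0 := by
        rw [sub_self, abs_zero]; exact min_eq_left (mul_nonneg (by positivity) (hS0 _ _))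
      rwa [h3] at h2
  have hlim : Tendsto (fun τ => (∫ x, min |P τ x - P t x| (2 * C * S t x)) +
      C * ((∫ x, S τ x) - ∫ x, min (S τ x) (S t x))) (𝓝 t) (𝓝 0) := by
    have := hmin'.add ((hSint.sub hmin).const_mul C)
    simpa using this
  refine squeeze_zero' (Eventually.of_forall fun τ => integral_nonneg fun x => abs_nonneg _)
    ?_ hlim
  filter_upwards [hPS] with τ hτ
  have i1 : Integrable fun x => min |P τ x - P t x| (2 * C * S t x) :=
    (hPd τ).inf ((hS t).const_mul (2 * C))
  have i2 : Integrable fun x => min (S τ x) (S t x) := (hS τ).inf (hS t)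
  have i3 : Integrable fun x => C * (S τ x - min (S τ x) (S t x)) := ((hS τ).sub i2).const_mul C
  rw [← integral_sub (hS τ) i2, ← integral_const_mul, ← integral_add i1 i3]
  refine integral_mono (hPd τ) (i1.add i3) fun x => ?_
  have hPx : |P t x| ≤ C * S t x := by
    have := (hPt x).abs
    exact le_of_tendsto_of_tendsto this ((hSt x).const_mul C) (hPS.mono fun τ h => h x)
  have h1 := hτ x
  have h2 : |P τ x - P t x| ≤ C * S τ x + C * S t x := by
    have := abs_sub (P τ x) (P t x); linarith
  change |P τ x - P t x| ≤ min |P τ x - P t x| (2 * C * S t x) + C * (S τ x - min (S τ x) (S t x))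
  have h3 : 0 ≤ C * (S τ x - min (S τ x) (S t x)) :=
    mul_nonneg hC (sub_nonneg.2 (min_le_left _ _))
  have h4 : C * min (S τ x) (S t x) ≤ C * S t x := mul_le_mul_of_nonneg_left (min_le_right _ _) hC
  rcases min_cases |P τ x - P t x| (2 * C * S t x) with ⟨h, -⟩ | ⟨h, -⟩ <;> rw [h] <;> linarith

lemma sq_le_of_hasDerivAt {g g' : ℝ → ℝ} (hg : ∀ x, HasDerivAt g (g' x) x)
    (h0 : Integrable fun x => g x ^ 2) (h1 : Integrable fun x => g' x ^ 2)
    (hg' : Continuous g') (hlim : Tendsto g atBot (𝓝 0)) {l : ℝ} (hl : 0 < l) (x : ℝ) :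
    g x ^ 2 ≤ l * (∫ y, g' y ^ 2) + l⁻¹ * ∫ y, g y ^ 2 := by
  have cg : Continuous g := continuous_iff_continuousAt.2 fun x => (hg x).continuousAt
  have hb : ∀ y, |2 * (g y * g' y)| ≤ l * g' y ^ 2 + l⁻¹ * g y ^ 2 := fun y => by
    have e : ∀ σ : ℝ, σ ^ 2 = 1 →
        l * g' y ^ 2 + l⁻¹ * g y ^ 2 - σ * (2 * (g y * g' y)) = l⁻¹ * (l * g' y - σ * g y) ^ 2 := by
      intro σ hσ
      field_simp
      linear_combination -g y ^ 2 * hσ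
    have e1 := e 1 (by norm_num)
    have e2 := e (-1) (by norm_num)
    have p1 : 0 ≤ l⁻¹ * (l * g' y - 1 * g y) ^ 2 := by positivity
    have p2 : 0 ≤ l⁻¹ * (l * g' y - (-1) * g y) ^ 2 := by positivity
    rw [abs_le]; constructor <;> linarith
  have hi : Integrable fun y => l * g' y ^ 2 + l⁻¹ * g y ^ 2 :=
    (h1.const_mul l).add (h0.const_mul l⁻¹)
  have hI : Integrable fun y => 2 * (g y * g' y) :=
    hi.mono' (by fun_prop) (ae_of_all _ hb)
  have := integral_Iic_of_hasDerivAt_of_tendsto' (f := fun y => g y ^ 2)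
    (f' := fun y => 2 * (g y * g' y)) (a := x) (m := 0)
    (fun y _ => ((hg y).pow 2).congr_deriv (by push_cast; ring)) hI.integrableOn
    (by simpa using hlim.pow 2)
  rw [sub_zero] at this
  rw [← this, ← integral_const_mul, ← integral_const_mul,
    ← integral_add (h1.const_mul l) (h0.const_mul l⁻¹)]
  calc ∫ y in Set.Iic x, 2 * (g y * g' y) ≤ ∫ y in Set.Iic x, (l * g' y ^ 2 + l⁻¹ * g y ^ 2) :=
        integral_mono hI.integrableOn hi.integrableOn fun y => (le_abs_self _).trans (hb y)
    _ ≤ _ := setIntegral_le_integral hi (ae_of_all _ fun y => by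
        have := hl.le; show 0 ≤ l * g' y ^ 2 + l⁻¹ * g y ^ 2; positivity)

lemma sq_intervalIntegral_le {v : ℝ → ℝ} (hv : Continuous v) {h : ℝ} (hh : 0 < h) :
    (∫ s in (0 : ℝ)..h, v s) ^ 2 ≤ h * ∫ s in (0 : ℝ)..h, v s ^ 2 := by
  set I := ∫ s in (0 : ℝ)..h, v s with hI
  have h0 : 0 ≤ ∫ s in (0 : ℝ)..h, (h * v s - I) ^ 2 :=
    intervalIntegral.integral_nonneg hh.le fun s _ => sq_nonneg _
  have e : ∫ s in (0 : ℝ)..h, (h * v s - I) ^ 2 =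
      h ^ 2 * (∫ s in (0 : ℝ)..h, v s ^ 2) - 2 * h * I * I + h * I ^ 2 := by
    have : ∀ s, (h * v s - I) ^ 2 = h ^ 2 * v s ^ 2 - 2 * h * I * v s + I ^ 2 := fun s => by ring
    simp only [this]
    rw [intervalIntegral.integral_add, intervalIntegral.integral_sub,
      intervalIntegral.integral_const_mul, intervalIntegral.integral_const_mul,
      intervalIntegral.integral_const]
    · simp [← hI]
    all_goals apply Continuous.intervalIntegrable; fun_prop
  rw [e] at h0
  have : 0 ≤ h * (h * (∫ s in (0 : ℝ)..h, v s ^ 2) - I ^ 2) := by linarith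
  have := nonneg_of_mul_nonneg_right this hh
  linarith

lemma integral_sq_diffQuot_le {r r' : ℝ → ℝ} (hr : ∀ x, HasDerivAt r (r' x) x)
    (hc : Continuous r') (hi : Integrable fun x => r' x ^ 2) {h : ℝ} (hh : 0 < h) :
    Integrable (fun x => ((r (x + h) - r x) / h) ^ 2) ∧
      ∫ x, ((r (x + h) - r x) / h) ^ 2 ≤ ∫ x, r' x ^ 2 := by
  have cr : Continuous r := continuous_iff_continuousAt.2 fun x => (hr x).continuousAt
  have hprod : Integrable (fun z : ℝ × ℝ => r' (z.1 + z.2) ^ 2)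
      (volume.prod (volume.restrict (Set.Ioc 0 h))) := by
    rw [integrable_prod_iff' (by
      have : Continuous fun z : ℝ × ℝ => r' (z.1 + z.2) ^ 2 := by fun_prop
      exact this.aestronglyMeasurable)]
    refine ⟨ae_of_all _ fun s => hi.comp_add_right s, ?_⟩
    have : ∀ s, ∫ x, ‖r' (x + s) ^ 2‖ = ∫ x, r' x ^ 2 := fun s => by
      simp only [norm_pow, Real.norm_eq_abs, sq_abs]
      exact integral_add_right_eq_self (fun x => r' x ^ 2) s
    simp only [this]
    exact integrable_const _
  have hswap := integral_integral_swap (f := fun x s => r' (x + s) ^ 2) hprod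
  have hIx := hprod.integral_prod_left
  have hpt : ∀ x, ((r (x + h) - r x) / h) ^ 2 ≤ h⁻¹ * ∫ s in Set.Ioc 0 h, r' (x + s) ^ 2 := by
    intro x
    have e : r (x + h) - r x = ∫ s in (0 : ℝ)..h, r' (x + s) := by
      have := intervalIntegral.integral_eq_sub_of_hasDerivAt (a := 0) (b := h)
        (f := fun s => r (x + s)) (f' := fun s => r' (x + s))
        (fun s _ => (hr (x + s)).comp_const_add x s)
        (by apply Continuous.intervalIntegrable; fun_prop)
      simpa using this.symm
    rw [← intervalIntegral.integral_of_le hh.le, e, div_pow, div_le_iff₀ (by positivity)]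
    have := sq_intervalIntegral_le (v := fun s => r' (x + s)) (by fun_prop) hh
    refine this.trans (le_of_eq ?_)
    field_simp
  have hint : Integrable (fun x => ((r (x + h) - r x) / h) ^ 2) := by
    refine (hIx.const_mul h⁻¹).mono' (by fun_prop) (ae_of_all _ fun x => ?_)
    rw [Real.norm_eq_abs, abs_of_nonneg (sq_nonneg _)]
    exact hpt x
  refine ⟨hint, (integral_mono hint (hIx.const_mul h⁻¹) hpt).trans ?_⟩
  rw [integral_const_mul, hswap]
  have : ∀ s, ∫ x, r' (x + s) ^ 2 = ∫ x, r' x ^ 2 := fun s =>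
    integral_add_right_eq_self (fun x => r' x ^ 2) s
  simp only [this]
  simp [hh.le]
  rw [← mul_assoc, inv_mul_cancel₀ hh.ne', one_mul]

/-- Polynomial-type expressions in `(a, b, c, d)` which, as long as `a`, `b`, `c` stay bounded, are
controlled by `a² + b² + c² + d²`. -/
def QuadBdd (F : ℝ → ℝ → ℝ → ℝ → ℝ) : Prop :=
  ∀ K, ∃ C, 0 ≤ C ∧ ∀ a b c d, |a| ≤ K → |b| ≤ K → |c| ≤ K →
    |F a b c d| ≤ C * (a ^ 2 + b ^ 2 + c ^ 2 + d ^ 2)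

namespace QuadBdd

lemma add {F G : ℝ → ℝ → ℝ → ℝ → ℝ} (hF : QuadBdd F) (hG : QuadBdd G) :
    QuadBdd fun a b c d => F a b c d + G a b c d := by
  intro K
  obtain ⟨C, hC, h⟩ := hF K
  obtain ⟨D, hD, h'⟩ := hG K
  refine ⟨C + D, by positivity, fun a b c d ha hb hc => ?_⟩
  have := abs_add_le (F a b c d) (G a b c d)
  linarith [h a b c d ha hb hc, h' a b c d ha hb hc]

lemma const_mul {F : ℝ → ℝ → ℝ → ℝ → ℝ} (hF : QuadBdd F) (k : ℝ) :
    QuadBdd fun a b c d => k * F a b c d := by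
  intro K
  obtain ⟨C, hC, h⟩ := hF K
  refine ⟨|k| * C, by positivity, fun a b c d ha hb hc => ?_⟩
  rw [abs_mul, mul_assoc]
  exact mul_le_mul_of_nonneg_left (h a b c d ha hb hc) (abs_nonneg _)

lemma sq_right : QuadBdd fun _ _ _ d => d ^ 2 := fun K =>
  ⟨1, one_pos.le, fun a b c d _ _ _ => by
    rw [abs_of_nonneg (sq_nonneg d)]; linarith [sq_nonneg a, sq_nonneg b, sq_nonneg c]⟩

lemma monomial (i j k : ℕ) (h : 2 ≤ i + j + k) :
    QuadBdd fun a b c _ => a ^ i * b ^ j * c ^ k := by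
  intro K
  refine ⟨|K| ^ (i + j + k - 2), by positivity, fun a b c d ha hb hc => ?_⟩
  set m := max |a| (max |b| |c|) with hm
  have am : |a| ≤ m := le_max_left _ _
  have bm : |b| ≤ m := (le_max_left _ _).trans (le_max_right _ _)
  have cm : |c| ≤ m := (le_max_right _ _).trans (le_max_right _ _)
  have m0 : 0 ≤ m := (abs_nonneg _).trans am
  have mK : m ≤ |K| := (max_le ha (max_le hb hc)).trans (le_abs_self K)
  have m2 : m ^ 2 ≤ a ^ 2 + b ^ 2 + c ^ 2 + d ^ 2 := by
    rcases max_choice |a| (max |b| |c|) with h | h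
    · rw [hm, h, sq_abs]; linarith [sq_nonneg b, sq_nonneg c, sq_nonneg d]
    · rcases max_choice |b| |c| with h' | h'
      · rw [hm, h, h', sq_abs]; linarith [sq_nonneg a, sq_nonneg c, sq_nonneg d]
      · rw [hm, h, h', sq_abs]; linarith [sq_nonneg a, sq_nonneg b, sq_nonneg d]
  calc |a ^ i * b ^ j * c ^ k| = |a| ^ i * |b| ^ j * |c| ^ k := by
        rw [abs_mul, abs_mul, abs_pow, abs_pow, abs_pow]
    _ ≤ m ^ i * m ^ j * m ^ k := by gcongr
    _ = m ^ (i + j + k - 2) * m ^ 2 := by rw [← pow_add, ← pow_add, ← pow_add]; congr 1; omega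
    _ ≤ _ := by gcongr

end QuadBdd

/-- The spatial derivatives `U k = ∂ₓᵏ u` of a solution of mKdV whose first four slices decay. -/
structure MKdVJet (U : ℕ → ℝ → ℝ → ℝ) : Prop where
  cont : ∀ k, Continuous fun z : ℝ × ℝ => U k z.1 z.2
  dx : ∀ k t x, HasDerivAt (U k t) (U (k + 1) t x) x
  dt0 : ∀ t x, HasDerivAt (fun s => U 0 s x) (-(U 3 t x + 3 * U 0 t x ^ 2 * U 1 t x)) t
  dt1 : ∀ t x, HasDerivAt (fun s => U 1 s x)
    (-(U 4 t x + 6 * U 0 t x * U 1 t x ^ 2 + 3 * U 0 t x ^ 2 * U 2 t x)) t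
  dt2 : ∀ t x, HasDerivAt (fun s => U 2 s x)
    (-(U 5 t x + 6 * U 1 t x ^ 3 + 18 * (U 0 t x * U 1 t x * U 2 t x)
      + 3 * (U 0 t x ^ 2 * U 3 t x))) t
  decay : ∀ t, ∀ k ≤ 3, ∃ C, ∀ x, |U k t x| ≤ C * (1 + x ^ 2)⁻¹

/-- The squared `L²` norm of the `k`-th slice. -/
noncomputable def sqNorm (U : ℕ → ℝ → ℝ → ℝ) (k : ℕ) (t : ℝ) : ℝ := ∫ x, U k t x ^ 2

/-- The density of the squared `H³` norm. -/
def sobolevDensity (U : ℕ → ℝ → ℝ → ℝ) (t x : ℝ) : ℝ :=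
  U 0 t x ^ 2 + U 1 t x ^ 2 + U 2 t x ^ 2 + U 3 t x ^ 2

/-- The squared `H³` norm. -/
noncomputable def sobolevSq (U : ℕ → ℝ → ℝ → ℝ) (t : ℝ) : ℝ := ∫ x, sobolevDensity U t x

lemma sqNorm_nonneg (U : ℕ → ℝ → ℝ → ℝ) (k : ℕ) (t : ℝ) : 0 ≤ sqNorm U k t :=
  integral_nonneg fun _ => sq_nonneg _

lemma sobolevDensity_nonneg (U : ℕ → ℝ → ℝ → ℝ) (t x : ℝ) : 0 ≤ sobolevDensity U t x := by
  unfold sobolevDensity; positivity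

namespace MKdVJet

variable {U : ℕ → ℝ → ℝ → ℝ} (hU : MKdVJet U)
include hU

lemma cont_slice (k : ℕ) (t : ℝ) : Continuous (U k t) :=
  (hU.cont k).comp (by fun_prop : Continuous fun x : ℝ => (t, x))

lemma cont_time (k : ℕ) (x : ℝ) : Continuous fun t => U k t x :=
  (hU.cont k).comp (by fun_prop : Continuous fun t : ℝ => (t, x))

lemma integrable_sq {k : ℕ} (hk : k ≤ 3) (t : ℝ) : Integrable fun x => U k t x ^ 2 := by
  obtain ⟨C, hC⟩ := hU.decay t k hk
  refine (integrable_inv_one_add_sq.const_mul (C ^ 2)).mono'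
    ((hU.cont_slice k t).pow 2).aestronglyMeasurable (ae_of_all _ fun x => ?_)
  rw [norm_pow, Real.norm_eq_abs]
  have h1 : (1 + x ^ 2)⁻¹ ≤ 1 := inv_le_one_of_one_le₀ (by nlinarith [sq_nonneg x])
  have h0 : 0 ≤ (1 + x ^ 2)⁻¹ := by positivity
  calc |U k t x| ^ 2 ≤ (C * (1 + x ^ 2)⁻¹) ^ 2 := by gcongr; exact hC x
    _ = C ^ 2 * ((1 + x ^ 2)⁻¹ * (1 + x ^ 2)⁻¹) := by ring
    _ ≤ C ^ 2 * ((1 + x ^ 2)⁻¹ * 1) := by gcongr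
    _ = _ := by ring

lemma integrable_sobolevDensity (t : ℝ) : Integrable (sobolevDensity U t) :=
  (((hU.integrable_sq (by norm_num : 0 ≤ 3) t).add (hU.integrable_sq (by norm_num : 1 ≤ 3) t)).add
    (hU.integrable_sq (by norm_num : 2 ≤ 3) t)).add (hU.integrable_sq (le_refl 3) t)

lemma sobolevSq_eq (t : ℝ) :
    sobolevSq U t = sqNorm U 0 t + sqNorm U 1 t + sqNorm U 2 t + sqNorm U 3 t := by
  have i0 := hU.integrable_sq (by norm_num : 0 ≤ 3) t
  have i1 := hU.integrable_sq (by norm_num : 1 ≤ 3) t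
  have i2 := hU.integrable_sq (by norm_num : 2 ≤ 3) t
  have i3 := hU.integrable_sq (le_refl 3) t
  have k1 : Integrable fun x => U 0 t x ^ 2 + U 1 t x ^ 2 := i0.add i1
  have k2 : Integrable fun x => U 0 t x ^ 2 + U 1 t x ^ 2 + U 2 t x ^ 2 := k1.add i2
  unfold sobolevSq sobolevDensity sqNorm
  rw [integral_add k2 i3, integral_add k1 i2, integral_add i0 i1]

lemma tendsto_atBot {k : ℕ} (hk : k ≤ 3) (t : ℝ) : Tendsto (U k t) atBot (𝓝 0) := by
  obtain ⟨C, hC⟩ := hU.decay t k hk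
  have h0 : Tendsto (fun x : ℝ => x ^ 2) atBot atTop :=
    ((tendsto_pow_atTop two_ne_zero).comp tendsto_abs_atBot_atTop).congr fun x => sq_abs x
  have h1 : Tendsto (fun x : ℝ => 1 + x ^ 2) atBot atTop := tendsto_atTop_add_const_left _ _ h0
  have h2 := h1.inv_tendsto_atTop.const_mul C
  rw [mul_zero] at h2
  exact squeeze_zero_norm hC h2

lemma sq_le {k : ℕ} (hk : k ≤ 2) {l : ℝ} (hl : 0 < l) (t x : ℝ) :
    U k t x ^ 2 ≤ l * sqNorm U (k + 1) t + l⁻¹ * sqNorm U k t :=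
  sq_le_of_hasDerivAt (hU.dx k t) (hU.integrable_sq (by omega) t) (hU.integrable_sq (by omega) t)
    (hU.cont_slice _ t) (hU.tendsto_atBot (by omega) t) hl x

lemma sq_le_add {k : ℕ} (hk : k ≤ 2) (t x : ℝ) :
    U k t x ^ 2 ≤ sqNorm U k t + sqNorm U (k + 1) t := by
  have := hU.sq_le hk one_pos t x
  rw [inv_one, one_mul, one_mul] at this
  linarith

lemma abs_le {k : ℕ} (hk : k ≤ 2) (t x : ℝ) : |U k t x| ≤ 1 + sobolevSq U t := by
  have h := hU.sq_le_add hk t x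
  have h0 : sqNorm U k t + sqNorm U (k + 1) t ≤ sobolevSq U t := by
    rw [hU.sobolevSq_eq]
    have := sqNorm_nonneg U 0 t; have := sqNorm_nonneg U 1 t
    have := sqNorm_nonneg U 2 t; have := sqNorm_nonneg U 3 t
    interval_cases k <;> simp only [zero_add, Nat.reduceAdd] <;> linarith
  refine abs_le_of_sq_le_sq (by nlinarith [sq_nonneg (U k t x)]) ?_
  nlinarith [sq_nonneg (U k t x)]

lemma quadBdd_pointwise {F : ℝ → ℝ → ℝ → ℝ → ℝ} (hF : QuadBdd F) (B : ℝ) :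
    ∃ C, 0 ≤ C ∧ ∀ t, sobolevSq U t ≤ B →
      ∀ x, |F (U 0 t x) (U 1 t x) (U 2 t x) (U 3 t x)| ≤ C * sobolevDensity U t x := by
  obtain ⟨C, hC, h⟩ := hF (1 + B)
  refine ⟨C, hC, fun t ht x => ?_⟩
  have hk : ∀ k ≤ 2, |U k t x| ≤ 1 + B := fun k hk => (hU.abs_le hk t x).trans (by linarith)
  exact h _ _ _ _ (hk 0 (by norm_num)) (hk 1 (by norm_num)) (hk 2 (by norm_num))

lemma integrable_quadBdd {F : ℝ → ℝ → ℝ → ℝ → ℝ} (hF : QuadBdd F)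
    (hc : ∀ t, Continuous fun x => F (U 0 t x) (U 1 t x) (U 2 t x) (U 3 t x)) (t : ℝ) :
    Integrable fun x => F (U 0 t x) (U 1 t x) (U 2 t x) (U 3 t x) := by
  obtain ⟨C, -, h⟩ := hU.quadBdd_pointwise hF (sobolevSq U t)
  exact ((hU.integrable_sobolevDensity t).const_mul C).mono' (hc t).aestronglyMeasurable
    (ae_of_all _ (h t le_rfl))

lemma integral_abs_quadBdd_le {F : ℝ → ℝ → ℝ → ℝ → ℝ} (hF : QuadBdd F)
    (hc : ∀ t, Continuous fun x => F (U 0 t x) (U 1 t x) (U 2 t x) (U 3 t x)) (B : ℝ) :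
    ∃ C, ∀ t, sobolevSq U t ≤ B →
      ∫ x, |F (U 0 t x) (U 1 t x) (U 2 t x) (U 3 t x)| ≤ C := by
  obtain ⟨C, hC, h⟩ := hU.quadBdd_pointwise hF B
  refine ⟨C * B, fun t ht => ?_⟩
  calc _ ≤ ∫ x, C * sobolevDensity U t x :=
        integral_mono (hU.integrable_quadBdd hF hc t).abs
          ((hU.integrable_sobolevDensity t).const_mul C) (h t ht)
    _ = C * sobolevSq U t := integral_const_mul _ _
    _ ≤ C * B := mul_le_mul_of_nonneg_left ht hC

/-- A conservation law without source whose density and fluxes are polynomial in the jet gives a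
constant of motion on every interval on which the `H³` norm is bounded. -/
lemma integral_eq_of_balanceLaw {E P Q R : ℝ → ℝ → ℝ → ℝ → ℝ}
    (hE : QuadBdd E) (hP : QuadBdd P) (hQ : QuadBdd Q) (hR : QuadBdd R)
    (cE : ∀ t, Continuous fun x => E (U 0 t x) (U 1 t x) (U 2 t x) (U 3 t x))
    (cP : ∀ t, Continuous fun x => P (U 0 t x) (U 1 t x) (U 2 t x) (U 3 t x))
    (cQ : ∀ t, Continuous fun x => Q (U 0 t x) (U 1 t x) (U 2 t x) (U 3 t x))
    (cR : ∀ t, Continuous fun x => R (U 0 t x) (U 1 t x) (U 2 t x) (U 3 t x))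
    (h : BalanceLaw (fun t x => E (U 0 t x) (U 1 t x) (U 2 t x) (U 3 t x)) (fun _ _ => 0)
      (fun t x => P (U 0 t x) (U 1 t x) (U 2 t x) (U 3 t x))
      (fun t x => Q (U 0 t x) (U 1 t x) (U 2 t x) (U 3 t x))
      (fun t x => R (U 0 t x) (U 1 t x) (U 2 t x) (U 3 t x)))
    {J : Set ℝ} (hJ : Convex ℝ J) {B : ℝ} (hB : ∀ τ ∈ J, sobolevSq U τ ≤ B) {τ₁ τ₂ : ℝ}
    (h₁ : τ₁ ∈ J) (h₂ : τ₂ ∈ J) :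
    ∫ x, E (U 0 τ₁ x) (U 1 τ₁ x) (U 2 τ₁ x) (U 3 τ₁ x) =
      ∫ x, E (U 0 τ₂ x) (U 1 τ₂ x) (U 2 τ₂ x) (U 3 τ₂ x) := by
  obtain ⟨C₁, hC₁⟩ := hU.integral_abs_quadBdd_le hP cP B
  obtain ⟨C₂, hC₂⟩ := hU.integral_abs_quadBdd_le hQ cQ B
  obtain ⟨C₃, hC₃⟩ := hU.integral_abs_quadBdd_le hR cR B
  have := h.abs_integral_sub_le (hU.integrable_quadBdd hE cE) (fun _ => integrable_zero _ _ _)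
    (hU.integrable_quadBdd hP cP) (hU.integrable_quadBdd hQ cQ) (hU.integrable_quadBdd hR cR)
    hJ (Γ := 0) (B := max C₁ (max C₂ C₃)) (fun τ _ => by simp)
    (fun τ hτ => (hC₁ τ (hB τ hτ)).trans (le_max_left _ _))
    (fun τ hτ => (hC₂ τ (hB τ hτ)).trans ((le_max_left _ _).trans (le_max_right _ _)))
    (fun τ hτ => (hC₃ τ (hB τ hτ)).trans ((le_max_right _ _).trans (le_max_right _ _))) h₁ h₂
  rw [zero_mul] at this
  exact sub_eq_zero.1 (abs_eq_zero.1 (le_antisymm this (abs_nonneg _)))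

end MKdVJet

/-- The flux of the second conserved quantity multiplying the first derivative of the weight. -/
noncomputable def secondFlux (a b c d : ℝ) : ℝ :=
  -(3 / 2) * d ^ 2 + 9 * c ^ 2 * a ^ 2 + 15 * b ^ 2 * a * c + (9 / 16) * a ^ 8 + (1 / 4) * b ^ 4
    + (3 / 2) * c * a ^ 5 - (45 / 4) * a ^ 4 * b ^ 2

/-- The density of the second conserved quantity. -/
noncomputable def secondDensity (a b c : ℝ) : ℝ :=
  (1 / 2) * c ^ 2 - (5 / 2) * a ^ 2 * b ^ 2 + (1 / 4) * a ^ 6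

lemma quadBdd_secondFlux : QuadBdd secondFlux := by
  have h := ((((((QuadBdd.sq_right.const_mul (-(3 / 2))).add
    ((QuadBdd.monomial 2 0 2 (by norm_num)).const_mul 9)).add
    ((QuadBdd.monomial 1 2 1 (by norm_num)).const_mul 15)).add
    ((QuadBdd.monomial 8 0 0 (by norm_num)).const_mul (9 / 16))).add
    ((QuadBdd.monomial 0 4 0 (by norm_num)).const_mul (1 / 4))).add
    ((QuadBdd.monomial 5 0 1 (by norm_num)).const_mul (3 / 2))).add
    ((QuadBdd.monomial 4 2 0 (by norm_num)).const_mul (-(45 / 4)))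
  convert h using 5 with a b c d
  unfold secondFlux; ring

lemma quadBdd_secondDensity : QuadBdd fun a b c _ => secondDensity a b c := by
  have h := (((QuadBdd.monomial 0 0 2 (by norm_num)).const_mul (1 / 2)).add
    ((QuadBdd.monomial 2 2 0 (by norm_num)).const_mul (-(5 / 2)))).add
    ((QuadBdd.monomial 6 0 0 (by norm_num)).const_mul (1 / 4))
  convert h using 5 with a b c d
  unfold secondDensity; ring

namespace MKdVJet

variable {U : ℕ → ℝ → ℝ → ℝ} (hU : MKdVJet U)
include hU

lemma balanceLaw_mass : BalanceLaw (fun t x => U 0 t x ^ 2) (fun _ _ => 0)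
    (fun t x => -3 * U 1 t x ^ 2 + 3 / 2 * U 0 t x ^ 4) (fun _ _ => 0)
    (fun t x => U 0 t x ^ 2) := by
  have c := hU.cont
  have s := hU.cont_slice
  have d0 : ∀ t x, HasDerivAt (U 0 t) (U 1 t x) x := hU.dx 0
  have d1 : ∀ t x, HasDerivAt (U 1 t) (U 2 t x) x := hU.dx 1
  have d2 : ∀ t x, HasDerivAt (U 2 t) (U 3 t x) x := hU.dx 2
  have d3 : ∀ t x, HasDerivAt (U 3 t) (U 4 t x) x := hU.dx 3
  have d4 : ∀ t x, HasDerivAt (U 4 t) (U 5 t x) x := hU.dx 4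
  refine balanceLaw_of_hasDerivAt (e' := fun t x =>
      2 * U 0 t x * (-(U 3 t x + 3 * U 0 t x ^ 2 * U 1 t x)))
    (p₁ := fun t x => -6 * U 1 t x * U 2 t x + 6 * U 0 t x ^ 3 * U 1 t x)
    (q₁ := fun _ _ => 0) (q₂ := fun _ _ => 0) (r₁ := fun t x => 2 * U 0 t x * U 1 t x)
    (r₂ := fun t x => 2 * U 1 t x ^ 2 + 2 * U 0 t x * U 2 t x)
    (r₃ := fun t x => 6 * U 1 t x * U 2 t x + 2 * U 0 t x * U 3 t x)
    ?_ ?_ ?_ ?_ ?_ ?_ ?_ ?_ ?_ ?_ ?_ ?_ ?_ ?_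
  · intro t; fun_prop
  · fun_prop
  · intro t x
    exact ((hU.dt0 t x).pow 2).congr_deriv (by push_cast [Pi.mul_apply, Pi.pow_apply]; ring)
  · intro t; fun_prop
  · intro t x
    exact ((((d1 t x).pow 2).const_mul (-3)).add (((d0 t x).pow 4).const_mul (3 / 2))).congr_deriv
      (by push_cast [Pi.mul_apply, Pi.pow_apply]; ring)
  · intro t; fun_prop
  · intro t x; exact hasDerivAt_const _ _
  · intro t x; exact hasDerivAt_const _ _
  · intro t; fun_prop
  · intro t x
    exact ((d0 t x).pow 2).congr_deriv (by push_cast [Pi.mul_apply, Pi.pow_apply]; ring)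
  · intro t x
    exact (((d0 t x).const_mul 2).mul (d1 t x)).congr_deriv (by ring)
  · intro t x
    exact ((((d1 t x).pow 2).const_mul 2).add (((d0 t x).const_mul 2).mul (d2 t x))).congr_deriv
      (by push_cast [Pi.mul_apply, Pi.pow_apply]; ring)
  · intro t; fun_prop
  · intro t x; ring

lemma balanceLaw_energy : BalanceLaw (fun t x => 1 / 2 * U 1 t x ^ 2 - 1 / 4 * U 0 t x ^ 4)
    (fun _ _ => 0)
    (fun t x => -(3 / 2) * U 2 t x ^ 2 + 3 * U 0 t x ^ 2 * U 1 t x ^ 2 - U 0 t x ^ 3 * U 2 t x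
      - 1 / 2 * U 0 t x ^ 6) (fun _ _ => 0)
    (fun t x => 1 / 2 * U 1 t x ^ 2) := by
  have c := hU.cont
  have s := hU.cont_slice
  have d0 : ∀ t x, HasDerivAt (U 0 t) (U 1 t x) x := hU.dx 0
  have d1 : ∀ t x, HasDerivAt (U 1 t) (U 2 t x) x := hU.dx 1
  have d2 : ∀ t x, HasDerivAt (U 2 t) (U 3 t x) x := hU.dx 2
  have d3 : ∀ t x, HasDerivAt (U 3 t) (U 4 t x) x := hU.dx 3
  have d4 : ∀ t x, HasDerivAt (U 4 t) (U 5 t x) x := hU.dx 4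
  refine balanceLaw_of_hasDerivAt (e' := fun t x =>
      U 1 t x * (-(U 4 t x + 6 * U 0 t x * U 1 t x ^ 2 + 3 * U 0 t x ^ 2 * U 2 t x))
      - U 0 t x ^ 3 * (-(U 3 t x + 3 * U 0 t x ^ 2 * U 1 t x)))
    (p₁ := fun t x => -3 * U 2 t x * U 3 t x + 6 * U 0 t x * U 1 t x ^ 3
      + 3 * U 0 t x ^ 2 * U 1 t x * U 2 t x
      - U 0 t x ^ 3 * U 3 t x - 3 * U 0 t x ^ 5 * U 1 t x)
    (q₁ := fun _ _ => 0) (q₂ := fun _ _ => 0) (r₁ := fun t x => U 1 t x * U 2 t x)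
    (r₂ := fun t x => U 2 t x ^ 2 + U 1 t x * U 3 t x)
    (r₃ := fun t x => 3 * U 2 t x * U 3 t x + U 1 t x * U 4 t x)
    ?_ ?_ ?_ ?_ ?_ ?_ ?_ ?_ ?_ ?_ ?_ ?_ ?_ ?_
  · intro t; fun_prop
  · fun_prop
  · intro t x
    exact ((((hU.dt1 t x).pow 2).const_mul (1 / 2)).sub
      (((hU.dt0 t x).pow 4).const_mul (1 / 4))).congr_deriv
        (by push_cast [Pi.mul_apply, Pi.pow_apply]; ring)
  · intro t; fun_prop
  · intro t x
    exact ((((((d2 t x).pow 2).const_mul (-(3 / 2))).add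
      ((((d0 t x).pow 2).const_mul 3).mul ((d1 t x).pow 2))).sub
      (((d0 t x).pow 3).mul (d2 t x))).sub (((d0 t x).pow 6).const_mul (1 / 2))).congr_deriv
      (by push_cast [Pi.mul_apply, Pi.pow_apply]; ring)
  · intro t; fun_prop
  · intro t x; exact hasDerivAt_const _ _
  · intro t x; exact hasDerivAt_const _ _
  · intro t; fun_prop
  · intro t x
    exact (((d1 t x).pow 2).const_mul (1 / 2)).congr_deriv
      (by push_cast [Pi.mul_apply, Pi.pow_apply]; ring)
  · intro t x
    exact ((d1 t x).mul (d2 t x)).congr_deriv (by ring)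
  · intro t x
    exact (((d2 t x).pow 2).add ((d1 t x).mul (d3 t x))).congr_deriv
      (by push_cast [Pi.mul_apply, Pi.pow_apply]; ring)
  · intro t; fun_prop
  · intro t x; ring

lemma balanceLaw_second :
    BalanceLaw (fun t x => secondDensity (U 0 t x) (U 1 t x) (U 2 t x)) (fun _ _ => 0)
    (fun t x => secondFlux (U 0 t x) (U 1 t x) (U 2 t x) (U 3 t x))
    (fun t x => 5 * (U 0 t x ^ 2 * U 1 t x * U 2 t x))
    (fun t x => 1 / 2 * U 2 t x ^ 2) := by
  have c := hU.cont
  have s := hU.cont_slice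
  have d0 : ∀ t x, HasDerivAt (U 0 t) (U 1 t x) x := hU.dx 0
  have d1 : ∀ t x, HasDerivAt (U 1 t) (U 2 t x) x := hU.dx 1
  have d2 : ∀ t x, HasDerivAt (U 2 t) (U 3 t x) x := hU.dx 2
  have d3 : ∀ t x, HasDerivAt (U 3 t) (U 4 t x) x := hU.dx 3
  have d4 : ∀ t x, HasDerivAt (U 4 t) (U 5 t x) x := hU.dx 4
  unfold secondFlux secondDensity
  refine balanceLaw_of_hasDerivAt (e' := fun t x =>
      U 2 t x * (-(U 5 t x + 6 * U 1 t x ^ 3 + 18 * (U 0 t x * U 1 t x * U 2 t x)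
        + 3 * (U 0 t x ^ 2 * U 3 t x)))
      - 5 * U 0 t x ^ 2 * U 1 t x *
        (-(U 4 t x + 6 * U 0 t x * U 1 t x ^ 2 + 3 * U 0 t x ^ 2 * U 2 t x))
      + (3 / 2 * U 0 t x ^ 5 - 5 * U 0 t x * U 1 t x ^ 2) *
        (-(U 3 t x + 3 * U 0 t x ^ 2 * U 1 t x)))
    (p₁ := fun t x => -3 * U 3 t x * U 4 t x + 18 * U 2 t x * U 3 t x * U 0 t x ^ 2
      + 18 * U 2 t x ^ 2 * U 0 t x * U 1 t x + 30 * U 1 t x * U 2 t x ^ 2 * U 0 t x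
      + 15 * U 1 t x ^ 3 * U 2 t x + 15 * U 1 t x ^ 2 * U 0 t x * U 3 t x
      + 9 / 2 * U 0 t x ^ 7 * U 1 t x + U 1 t x ^ 3 * U 2 t x
      + 3 / 2 * U 3 t x * U 0 t x ^ 5 + 15 / 2 * U 2 t x * U 0 t x ^ 4 * U 1 t x
      - 45 * U 0 t x ^ 3 * U 1 t x ^ 3 - 45 / 2 * U 0 t x ^ 4 * U 1 t x * U 2 t x)
    (q₁ := fun t x => 10 * U 0 t x * U 1 t x ^ 2 * U 2 t x + 5 * U 0 t x ^ 2 * U 2 t x ^ 2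
      + 5 * U 0 t x ^ 2 * U 1 t x * U 3 t x)
    (q₂ := fun t x => 10 * U 1 t x ^ 3 * U 2 t x + 20 * U 0 t x * U 1 t x * U 2 t x ^ 2
      + 10 * U 0 t x * U 1 t x ^ 2 * U 3 t x
      + 10 * U 0 t x * U 1 t x * U 2 t x ^ 2 + 10 * U 0 t x ^ 2 * U 2 t x * U 3 t x
      + 10 * U 0 t x * U 1 t x ^ 2 * U 3 t x + 5 * U 0 t x ^ 2 * U 2 t x * U 3 t x
      + 5 * U 0 t x ^ 2 * U 1 t x * U 4 t x)
    (r₁ := fun t x => U 2 t x * U 3 t x)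
    (r₂ := fun t x => U 3 t x ^ 2 + U 2 t x * U 4 t x)
    (r₃ := fun t x => 3 * U 3 t x * U 4 t x + U 2 t x * U 5 t x)
    ?_ ?_ ?_ ?_ ?_ ?_ ?_ ?_ ?_ ?_ ?_ ?_ ?_ ?_
  · intro t; fun_prop
  · fun_prop
  · intro t x
    exact (((((hU.dt2 t x).pow 2).const_mul (1 / 2)).sub
      ((((hU.dt0 t x).pow 2).const_mul (5 / 2)).mul ((hU.dt1 t x).pow 2))).add
      (((hU.dt0 t x).pow 6).const_mul (1 / 4))).congr_deriv
        (by push_cast [Pi.mul_apply, Pi.pow_apply]; ring)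
  · intro t; fun_prop
  · intro t x
    exact ((((((((((d3 t x).pow 2).const_mul (-(3 / 2))).add
      ((((d2 t x).pow 2).const_mul 9).mul ((d0 t x).pow 2))).add
      (((((d1 t x).pow 2).const_mul 15).mul (d0 t x)).mul (d2 t x))).add
      (((d0 t x).pow 8).const_mul (9 / 16))).add
      (((d1 t x).pow 4).const_mul (1 / 4))).add
      (((d2 t x).const_mul (3 / 2)).mul ((d0 t x).pow 5))).sub
      ((((d0 t x).pow 4).const_mul (45 / 4)).mul ((d1 t x).pow 2))).congr_deriv
      (by push_cast [Pi.mul_apply, Pi.pow_apply]; ring))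
  · intro t; fun_prop
  · intro t x
    exact (((((d0 t x).pow 2).mul (d1 t x)).mul (d2 t x)).const_mul 5).congr_deriv
      (by push_cast [Pi.mul_apply, Pi.pow_apply]; ring)
  · intro t x
    exact ((((((d0 t x).const_mul 10).mul ((d1 t x).pow 2)).mul (d2 t x)).add
      ((((d0 t x).pow 2).const_mul 5).mul ((d2 t x).pow 2))).add
      (((((d0 t x).pow 2).const_mul 5).mul (d1 t x)).mul (d3 t x))).congr_deriv
      (by push_cast [Pi.mul_apply, Pi.pow_apply]; ring)
  · intro t; fun_prop
  · intro t x
    exact (((d2 t x).pow 2).const_mul (1 / 2)).congr_deriv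
      (by push_cast [Pi.mul_apply, Pi.pow_apply]; ring)
  · intro t x
    exact ((d2 t x).mul (d3 t x)).congr_deriv (by ring)
  · intro t x
    exact (((d3 t x).pow 2).add ((d2 t x).mul (d4 t x))).congr_deriv
      (by push_cast [Pi.mul_apply, Pi.pow_apply]; ring)
  · intro t; fun_prop
  · intro t x; ring

end MKdVJet

/-- The squared `H²` norm. -/
noncomputable def lowSq (U : ℕ → ℝ → ℝ → ℝ) (t : ℝ) : ℝ :=
  sqNorm U 0 t + sqNorm U 1 t + sqNorm U 2 t

/-- A bound for the squared `H²` norm in terms of its value at another time. -/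
noncomputable def lowBound (M : ℝ) : ℝ :=
  2 * M + (2 * M + (M + 1) * M ^ 2) + 1 / 2 * M ^ 3
    + 5 * (M + (2 * M + (M + 1) * M ^ 2)) * (2 * M + (M + 1) * M ^ 2)

lemma QuadBdd.zero : QuadBdd fun _ _ _ _ => 0 := by
  simpa using QuadBdd.sq_right.const_mul 0

namespace MKdVJet

variable {U : ℕ → ℝ → ℝ → ℝ} (hU : MKdVJet U)
include hU

lemma integrable_monomial (i j k : ℕ) (h : 2 ≤ i + j + k) (t : ℝ) :
    Integrable fun x => U 0 t x ^ i * U 1 t x ^ j * U 2 t x ^ k := by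
  have s := hU.cont_slice
  exact hU.integrable_quadBdd (QuadBdd.monomial i j k h) (fun t => by fun_prop) t

lemma integral_mul_sq_le {F : ℝ → ℝ} {k : ℕ} (hk : k ≤ 3) {t C : ℝ}
    (hF : Integrable fun x => F x * U k t x ^ 2) (hC : ∀ x, F x ≤ C) :
    ∫ x, F x * U k t x ^ 2 ≤ C * sqNorm U k t := by
  rw [sqNorm, ← integral_const_mul]
  exact integral_mono hF ((hU.integrable_sq hk t).const_mul C)
    fun x => mul_le_mul_of_nonneg_right (hC x) (sq_nonneg _)

lemma integral_energy (t : ℝ) : ∫ x, (1 / 2 * U 1 t x ^ 2 - 1 / 4 * U 0 t x ^ 4) =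
    1 / 2 * sqNorm U 1 t - 1 / 4 * ∫ x, U 0 t x ^ 4 := by
  have i4 : Integrable fun x => U 0 t x ^ 4 := by
    simpa using hU.integrable_monomial 4 0 0 (by norm_num) t
  rw [integral_sub ((hU.integrable_sq (by norm_num : 1 ≤ 3) t).const_mul _) (i4.const_mul _),
    integral_const_mul, integral_const_mul, sqNorm]

lemma integral_secondDensity (t : ℝ) :
    ∫ x, secondDensity (U 0 t x) (U 1 t x) (U 2 t x) =
      1 / 2 * sqNorm U 2 t - 5 / 2 * (∫ x, U 0 t x ^ 2 * U 1 t x ^ 2)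
        + 1 / 4 * ∫ x, U 0 t x ^ 6 := by
  have i2 : Integrable fun x => 1 / 2 * U 2 t x ^ 2 :=
    (hU.integrable_sq (by norm_num : 2 ≤ 3) t).const_mul _
  have i22 : Integrable fun x => 5 / 2 * (U 0 t x ^ 2 * U 1 t x ^ 2) := by
    simpa using (hU.integrable_monomial 2 2 0 (by norm_num) t).const_mul (5 / 2)
  have i6 : Integrable fun x => 1 / 4 * U 0 t x ^ 6 := by
    simpa using (hU.integrable_monomial 6 0 0 (by norm_num) t).const_mul (1 / 4)
  have i3 : Integrable fun x => 1 / 2 * U 2 t x ^ 2 - 5 / 2 * (U 0 t x ^ 2 * U 1 t x ^ 2) :=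
    i2.sub i22
  rw [sqNorm, ← integral_const_mul, ← integral_const_mul, ← integral_const_mul,
    ← integral_sub i2 i22, ← integral_add i3 i6]
  congr 1 with x
  unfold secondDensity; ring

section Conservation

variable {J : Set ℝ} (hJ : Convex ℝ J) {B : ℝ} (hB : ∀ τ ∈ J, sobolevSq U τ ≤ B) {a s : ℝ}
  (ha : a ∈ J) (hs : s ∈ J)
include hJ hB ha hs

lemma mass_eq : sqNorm U 0 s = sqNorm U 0 a := by
  have c := hU.cont_slice
  have hP : QuadBdd fun a b _ _ => -3 * b ^ 2 + 3 / 2 * a ^ 4 := by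
    simpa using ((QuadBdd.monomial 0 2 0 (by norm_num)).const_mul (-3)).add
      ((QuadBdd.monomial 4 0 0 (by norm_num)).const_mul (3 / 2))
  have hE : QuadBdd fun a _ _ _ => a ^ 2 := by
    simpa using QuadBdd.monomial 2 0 0 (by norm_num)
  exact hU.integral_eq_of_balanceLaw hE hP QuadBdd.zero hE (fun t => by fun_prop)
    (fun t => by fun_prop) (fun t => by fun_prop) (fun t => by fun_prop) hU.balanceLaw_mass
    hJ hB hs ha

lemma energy_eq : 1 / 2 * sqNorm U 1 s - 1 / 4 * (∫ x, U 0 s x ^ 4) =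
    1 / 2 * sqNorm U 1 a - 1 / 4 * ∫ x, U 0 a x ^ 4 := by
  have c := hU.cont_slice
  have hR : QuadBdd fun _ b _ _ => 1 / 2 * b ^ 2 := by
    simpa using (QuadBdd.monomial 0 2 0 (by norm_num)).const_mul (1 / 2)
  have hE : QuadBdd fun a b _ _ => 1 / 2 * b ^ 2 - 1 / 4 * a ^ 4 := by
    have := hR.add ((QuadBdd.monomial 4 0 0 (by norm_num)).const_mul (-(1 / 4)))
    convert this using 5
    ring
  have hP : QuadBdd fun a b c _ =>
      -(3 / 2) * c ^ 2 + 3 * a ^ 2 * b ^ 2 - a ^ 3 * c - 1 / 2 * a ^ 6 := by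
    have := ((((QuadBdd.monomial 0 0 2 (by norm_num)).const_mul (-(3 / 2))).add
      ((QuadBdd.monomial 2 2 0 (by norm_num)).const_mul 3)).add
      ((QuadBdd.monomial 3 0 1 (by norm_num)).const_mul (-1))).add
      ((QuadBdd.monomial 6 0 0 (by norm_num)).const_mul (-(1 / 2)))
    convert this using 5
    ring
  rw [← hU.integral_energy, ← hU.integral_energy]
  exact hU.integral_eq_of_balanceLaw hE hP QuadBdd.zero hR (fun t => by fun_prop)
    (fun t => by fun_prop) (fun t => by fun_prop) (fun t => by fun_prop) hU.balanceLaw_energy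
    hJ hB hs ha

lemma second_eq : 1 / 2 * sqNorm U 2 s - 5 / 2 * (∫ x, U 0 s x ^ 2 * U 1 s x ^ 2)
      + 1 / 4 * (∫ x, U 0 s x ^ 6) =
    1 / 2 * sqNorm U 2 a - 5 / 2 * (∫ x, U 0 a x ^ 2 * U 1 a x ^ 2)
      + 1 / 4 * ∫ x, U 0 a x ^ 6 := by
  have c := hU.cont_slice
  have hQ : QuadBdd fun a b c _ => 5 * (a ^ 2 * b * c) := by
    simpa using (QuadBdd.monomial 2 1 1 (by norm_num)).const_mul 5
  have hR : QuadBdd fun _ _ c _ => 1 / 2 * c ^ 2 := by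
    simpa using (QuadBdd.monomial 0 0 2 (by norm_num)).const_mul (1 / 2)
  rw [← hU.integral_secondDensity, ← hU.integral_secondDensity]
  exact hU.integral_eq_of_balanceLaw quadBdd_secondDensity quadBdd_secondFlux hQ hR
    (fun t => by unfold secondDensity; fun_prop)
    (fun t => by unfold secondFlux; fun_prop) (fun t => by fun_prop) (fun t => by fun_prop)
    hU.balanceLaw_second hJ hB hs ha

lemma lowSq_le {M : ℝ} (hM : lowSq U a ≤ M) : lowSq U s ≤ lowBound M := by
  have m := hU.mass_eq hJ hB ha hs
  have e := hU.energy_eq hJ hB ha hs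
  have f := hU.second_eq hJ hB ha hs
  have n0 := sqNorm_nonneg U 0 a
  have n1 := sqNorm_nonneg U 1 a
  have n2 := sqNorm_nonneg U 2 a
  have p1 := sqNorm_nonneg U 1 s
  unfold lowSq at *
  have hM0 : 0 ≤ M := by linarith
  have y0 : sqNorm U 0 s ≤ M := by linarith
  have p0 : 0 ≤ sqNorm U 0 s := sqNorm_nonneg U 0 s
  set y := sqNorm U 0 s with hy
  have h4 : ∫ x, U 0 s x ^ 4 ≤ sqNorm U 1 s + (M + 1) * M ^ 2 := by
    have i : Integrable fun x => U 0 s x ^ 2 * U 0 s x ^ 2 := by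
      simpa [← pow_add] using hU.integrable_monomial 4 0 0 (by norm_num) s
    have h := hU.integral_mul_sq_le (by norm_num : 0 ≤ 3) i
      fun x => hU.sq_le (by norm_num : 0 ≤ 2) (by positivity : 0 < (y + 1)⁻¹) s x
    simp only [← pow_add, inv_inv, ← hy, zero_add, Nat.reduceAdd] at h
    refine h.trans ?_
    have h1 : (y + 1)⁻¹ * y ≤ 1 := by
      rw [inv_mul_le_iff₀ (by positivity)]; linarith
    have h2 : (y + 1) * y ^ 2 ≤ (M + 1) * M ^ 2 := by gcongr
    nlinarith [mul_le_mul_of_nonneg_right h1 p1]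
  have q4 : 0 ≤ ∫ x, U 0 a x ^ 4 := integral_nonneg fun x => by positivity
  set β := 2 * M + (M + 1) * M ^ 2 with hβ
  have y1 : sqNorm U 1 s ≤ β := by linarith
  have hβ0 : 0 ≤ β := p1.trans y1
  have h22 : ∫ x, U 0 s x ^ 2 * U 1 s x ^ 2 ≤ (M + β) * β := by
    have i : Integrable fun x => U 0 s x ^ 2 * U 1 s x ^ 2 := by
      simpa using hU.integrable_monomial 2 2 0 (by norm_num) s
    have h := hU.integral_mul_sq_le (by norm_num : 1 ≤ 3) i
      fun x => (hU.sq_le_add (by norm_num : 0 ≤ 2) s x).trans (add_le_add y0 y1)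
    exact h.trans (by gcongr)
  have q22 : 0 ≤ ∫ x, U 0 a x ^ 2 * U 1 a x ^ 2 := integral_nonneg fun x => by positivity
  have q6 : 0 ≤ ∫ x, U 0 s x ^ 6 := integral_nonneg fun x => by positivity
  have h6 : ∫ x, U 0 a x ^ 6 ≤ M ^ 3 := by
    have i : Integrable fun x => U 0 a x ^ 4 * U 0 a x ^ 2 := by
      simpa [← pow_add] using hU.integrable_monomial 6 0 0 (by norm_num) a
    have hsup : ∀ x, U 0 a x ^ 4 ≤ M ^ 2 := fun x => by
      have h := hU.sq_le_add (by norm_num : 0 ≤ 2) a x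
      simp only [zero_add] at h
      calc U 0 a x ^ 4 = (U 0 a x ^ 2) ^ 2 := by ring
        _ ≤ M ^ 2 := by gcongr; linarith
    have h := hU.integral_mul_sq_le (by norm_num : 0 ≤ 3) i hsup
    simp only [← pow_add, Nat.reduceAdd] at h
    calc _ ≤ M ^ 2 * sqNorm U 0 a := h
      _ ≤ M ^ 2 * M := by gcongr; linarith
      _ = M ^ 3 := by ring
  unfold lowBound
  rw [← hβ]
  linarith

end Conservation

end MKdVJet

/-- The forward difference quotient with step `h` of a function of the second variable. -/
noncomputable def diffQuot (h : ℝ) (F : ℝ → ℝ → ℝ) (t x : ℝ) : ℝ := (F t (x + h) - F t x) / h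

lemma diffQuot_hasDerivAt {h : ℝ} {F F' : ℝ → ℝ → ℝ} (hF : ∀ t x, HasDerivAt (F t) (F' t x) x)
    (t x : ℝ) : HasDerivAt (diffQuot h F t) (diffQuot h F' t x) x :=
  (((hF t (x + h)).comp_add_const x h).sub (hF t x)).div_const h

/-- The cubic nonlinearity in the equation of the second derivative, except for its leading
part. -/
def cubicTerm (U : ℕ → ℝ → ℝ → ℝ) (t x : ℝ) : ℝ :=
  6 * U 1 t x ^ 3 + 18 * (U 0 t x * U 1 t x * U 2 t x)

/-- The spatial derivative of `cubicTerm`. -/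
def cubicTermDeriv (U : ℕ → ℝ → ℝ → ℝ) (t x : ℝ) : ℝ :=
  36 * U 1 t x ^ 2 * U 2 t x + 18 * U 0 t x * U 2 t x ^ 2 + 18 * (U 0 t x * U 1 t x) * U 3 t x

/-- The source in the balance law of the square of the difference quotient of the second
derivative. -/
noncomputable def diffQuotSource (U : ℕ → ℝ → ℝ → ℝ) (h t x : ℝ) : ℝ :=
  6 * U 0 t x * U 1 t x * diffQuot h (U 2) t x ^ 2
    - 2 * diffQuot h (U 2) t x * diffQuot h (cubicTerm U) t x
    - 6 * diffQuot h (U 2) t x * ((U 0 t (x + h) + U 0 t x) * diffQuot h (U 0) t x)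
      * U 3 t (x + h)

namespace MKdVJet

variable {U : ℕ → ℝ → ℝ → ℝ} (hU : MKdVJet U)
include hU

lemma balanceLaw_diffQuot (h : ℝ) :
    BalanceLaw (fun t x => diffQuot h (U 2) t x ^ 2) (diffQuotSource U h)
      (fun t x => -3 * diffQuot h (U 3) t x ^ 2 + 3 * U 0 t x ^ 2 * diffQuot h (U 2) t x ^ 2)
      (fun _ _ => 0) (fun t x => diffQuot h (U 2) t x ^ 2) := by
  have c := hU.cont
  have s := hU.cont_slice
  have d0 : ∀ t x, HasDerivAt (U 0 t) (U 1 t x) x := hU.dx 0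
  have D : ∀ k t x, HasDerivAt (diffQuot h (U k) t) (diffQuot h (U (k + 1)) t x) x :=
    fun k => diffQuot_hasDerivAt (hU.dx k)
  have D2 : ∀ t x, HasDerivAt (diffQuot h (U 2) t) (diffQuot h (U 3) t x) x := D 2
  have D3 : ∀ t x, HasDerivAt (diffQuot h (U 3) t) (diffQuot h (U 4) t x) x := D 3
  have D4 : ∀ t x, HasDerivAt (diffQuot h (U 4) t) (diffQuot h (U 5) t x) x := D 4
  have S : ∀ k t, Continuous (diffQuot h (U k) t) := fun k t => by
    unfold diffQuot; fun_prop
  have c' : ∀ k, Continuous fun z : ℝ × ℝ => U k z.1 (z.2 + h) := fun k =>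
    (hU.cont k).comp (by fun_prop : Continuous fun z : ℝ × ℝ => (z.1, z.2 + h))
  refine balanceLaw_of_hasDerivAt
    (e' := fun t x => 2 * diffQuot h (U 2) t x *
      ((-(U 5 t (x + h) + 6 * U 1 t (x + h) ^ 3
        + 18 * (U 0 t (x + h) * U 1 t (x + h) * U 2 t (x + h))
        + 3 * (U 0 t (x + h) ^ 2 * U 3 t (x + h)))
      - -(U 5 t x + 6 * U 1 t x ^ 3 + 18 * (U 0 t x * U 1 t x * U 2 t x)
        + 3 * (U 0 t x ^ 2 * U 3 t x))) / h))
    (p₁ := fun t x => -6 * diffQuot h (U 3) t x * diffQuot h (U 4) t x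
      + 6 * U 0 t x * U 1 t x * diffQuot h (U 2) t x ^ 2
      + 6 * U 0 t x ^ 2 * diffQuot h (U 2) t x * diffQuot h (U 3) t x)
    (q₁ := fun _ _ => 0) (q₂ := fun _ _ => 0)
    (r₁ := fun t x => 2 * diffQuot h (U 2) t x * diffQuot h (U 3) t x)
    (r₂ := fun t x => 2 * diffQuot h (U 3) t x ^ 2
      + 2 * diffQuot h (U 2) t x * diffQuot h (U 4) t x)
    (r₃ := fun t x => 6 * diffQuot h (U 3) t x * diffQuot h (U 4) t x
      + 2 * diffQuot h (U 2) t x * diffQuot h (U 5) t x)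
    ?_ ?_ ?_ ?_ ?_ ?_ ?_ ?_ ?_ ?_ ?_ ?_ ?_ ?_
  · intro t; fun_prop
  · unfold diffQuot; fun_prop
  · intro t x
    exact (((((hU.dt2 t (x + h)).sub (hU.dt2 t x)).div_const h).pow 2)).congr_deriv
      (by simp only [diffQuot, Pi.sub_apply]; push_cast; ring)
  · intro t
    unfold diffQuotSource cubicTerm diffQuot; fun_prop
  · intro t x
    exact ((((D3 t x).pow 2).const_mul (-3)).add
      ((((d0 t x).pow 2).const_mul 3).mul ((D2 t x).pow 2))).congr_deriv
      (by push_cast [Pi.mul_apply, Pi.pow_apply]; ring)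
  · intro t; fun_prop
  · intro t x; exact hasDerivAt_const _ _
  · intro t x; exact hasDerivAt_const _ _
  · intro t; fun_prop
  · intro t x
    exact ((D2 t x).pow 2).congr_deriv (by push_cast; ring)
  · intro t x
    exact (((D2 t x).const_mul 2).mul (D3 t x)).congr_deriv (by ring)
  · intro t x
    exact ((((D3 t x).pow 2).const_mul 2).add
      (((D2 t x).const_mul 2).mul (D4 t x))).congr_deriv (by push_cast; ring)
  · intro t; fun_prop
  · intro t x
    unfold diffQuotSource cubicTerm diffQuot; ring

lemma integrable_diffQuot_sq (t : ℝ) {h : ℝ} (hh : 0 < h) :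
    Integrable (fun x => diffQuot h (U 2) t x ^ 2) ∧
      ∫ x, diffQuot h (U 2) t x ^ 2 ≤ sqNorm U 3 t :=
  integral_sq_diffQuot_le (hU.dx 2 t) (hU.cont_slice 3 t) (hU.integrable_sq le_rfl t) hh

lemma integrable_diffQuot_three_sq (t h : ℝ) :
    Integrable (fun x => diffQuot h (U 3) t x ^ 2) ∧
      ∫ x, diffQuot h (U 3) t x ^ 2 ≤ 4 / h ^ 2 * sqNorm U 3 t := by
  have s := hU.cont_slice
  have i := hU.integrable_sq (le_refl 3) t
  have i' : Integrable fun x => U 3 t (x + h) ^ 2 := i.comp_add_right h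
  have k := (i'.add i).const_mul (2 / h ^ 2)
  have hle : ∀ x, diffQuot h (U 3) t x ^ 2 ≤ 2 / h ^ 2 * (U 3 t (x + h) ^ 2 + U 3 t x ^ 2) := by
    intro x
    have : diffQuot h (U 3) t x ^ 2 = 1 / h ^ 2 * (U 3 t (x + h) - U 3 t x) ^ 2 := by
      unfold diffQuot; ring
    rw [this, div_eq_mul_one_div 2, mul_comm 2, mul_assoc]
    gcongr
    linarith [sq_nonneg (U 3 t (x + h) + U 3 t x)]
  have m : Integrable (fun x => diffQuot h (U 3) t x ^ 2) :=
    k.mono' (by unfold diffQuot; fun_prop) (ae_of_all _ fun x => by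
      rw [Real.norm_eq_abs, abs_of_nonneg (sq_nonneg _)]; exact hle x)
  refine ⟨m, (integral_mono m k hle).trans_eq ?_⟩
  simp only [Pi.add_apply]
  rw [integral_const_mul, integral_add i' i,
    integral_add_right_eq_self fun x => U 3 t x ^ 2, sqNorm]
  ring

lemma cubicTerm_hasDerivAt (t x : ℝ) :
    HasDerivAt (cubicTerm U t) (cubicTermDeriv U t x) x := by
  have d0 : ∀ t x, HasDerivAt (U 0 t) (U 1 t x) x := hU.dx 0
  have d1 : ∀ t x, HasDerivAt (U 1 t) (U 2 t x) x := hU.dx 1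
  have d2 : ∀ t x, HasDerivAt (U 2 t) (U 3 t x) x := hU.dx 2
  exact ((((d1 t x).pow 3).const_mul 6).add
    ((((d0 t x).mul (d1 t x)).mul (d2 t x)).const_mul 18)).congr_deriv
    (by unfold cubicTermDeriv; push_cast [Pi.mul_apply, Pi.pow_apply]; ring)

lemma slice_sq_le {B t : ℝ} (hB : lowSq U t ≤ B) (x : ℝ) : U 0 t x ^ 2 ≤ B ∧ U 1 t x ^ 2 ≤ B := by
  have h0 := hU.sq_le_add (by norm_num : 0 ≤ 2) t x
  have h1 := hU.sq_le_add (by norm_num : 1 ≤ 2) t x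
  simp only [zero_add, Nat.reduceAdd] at h0 h1
  have := sqNorm_nonneg U 0 t
  have := sqNorm_nonneg U 2 t
  unfold lowSq at hB
  constructor <;> linarith

lemma integral_cubicTermDeriv_sq_le {B β t : ℝ} (hB : lowSq U t ≤ B) (hβ : sqNorm U 3 t ≤ β) :
    Integrable (fun x => cubicTermDeriv U t x ^ 2) ∧
      ∫ x, cubicTermDeriv U t x ^ 2 ≤ (4860 * B ^ 3 + 1944 * B ^ 2) * (1 + β) := by
  have s := hU.cont_slice
  have n0 := sqNorm_nonneg U 0 t
  have n1 := sqNorm_nonneg U 1 t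
  have n2 := sqNorm_nonneg U 2 t
  have n3 := sqNorm_nonneg U 3 t
  have hβ0 : 0 ≤ β := n3.trans hβ
  have hB2 : sqNorm U 2 t ≤ B := by unfold lowSq at hB; linarith
  have hB0 : 0 ≤ B := n2.trans hB2
  have i2 := hU.integrable_sq (by norm_num : 2 ≤ 3) t
  have i3 := hU.integrable_sq (le_refl 3) t
  have j2 := i2.const_mul (3888 * B ^ 2 + 972 * (B * (B + β)))
  have j3 := i3.const_mul (972 * B ^ 2)
  have hle : ∀ x, cubicTermDeriv U t x ^ 2 ≤
      (3888 * B ^ 2 + 972 * (B * (B + β))) * U 2 t x ^ 2 + 972 * B ^ 2 * U 3 t x ^ 2 := by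
    intro x
    obtain ⟨b0, b1⟩ := hU.slice_sq_le hB x
    have b2 : U 2 t x ^ 2 ≤ B + β :=
      (hU.sq_le_add (le_refl 2) t x).trans (add_le_add hB2 hβ)
    unfold cubicTermDeriv
    set a := U 0 t x
    set b := U 1 t x
    set c := U 2 t x
    set d := U 3 t x
    have hX : (b ^ 2) ^ 2 * c ^ 2 ≤ B ^ 2 * c ^ 2 := by gcongr
    have hY : a ^ 2 * c ^ 2 * c ^ 2 ≤ B * (B + β) * c ^ 2 := by gcongr
    have hZ : a ^ 2 * b ^ 2 * d ^ 2 ≤ B * B * d ^ 2 := by gcongr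
    nlinarith [sq_nonneg (36 * b ^ 2 * c - 18 * a * c ^ 2),
      sq_nonneg (36 * b ^ 2 * c - 18 * (a * b) * d), sq_nonneg (18 * a * c ^ 2 - 18 * (a * b) * d)]
  have m : Integrable (fun x => cubicTermDeriv U t x ^ 2) :=
    (j2.add j3).mono' (by unfold cubicTermDeriv; fun_prop) (ae_of_all _ fun x => by
      rw [Real.norm_eq_abs, abs_of_nonneg (sq_nonneg _)]; exact hle x)
  refine ⟨m, (integral_mono m (j2.add j3) hle).trans ?_⟩
  simp only [Pi.add_apply]
  rw [integral_add j2 j3, integral_const_mul, integral_const_mul]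
  change _ * sqNorm U 2 t + _ * sqNorm U 3 t ≤ _
  calc _ ≤ (3888 * B ^ 2 + 972 * (B * (B + β))) * B + 972 * B ^ 2 * β := by gcongr
    _ ≤ _ := by
      have h1 : 0 ≤ B ^ 3 * β := by positivity
      have h2 : 0 ≤ B ^ 2 := by positivity
      linarith

lemma abs_diffQuot_zero_le {h : ℝ} (hh : 0 < h) {K t : ℝ} (hK : ∀ x, |U 1 t x| ≤ K) (x : ℝ) :
    |diffQuot h (U 0) t x| ≤ K := by
  have := convex_univ.norm_image_sub_le_of_norm_hasDerivWithin_le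
    (fun y _ => (hU.dx 0 t y).hasDerivWithinAt) (fun y _ => hK y) (Set.mem_univ x)
    (Set.mem_univ (x + h))
  rw [add_sub_cancel_left, Real.norm_eq_abs, Real.norm_eq_abs, abs_of_pos hh] at this
  rw [diffQuot, abs_div, abs_of_pos hh, div_le_iff₀ hh]
  exact this

lemma integral_abs_diffQuotSource_le {B β t : ℝ} (hB : lowSq U t ≤ B) (hβ : sqNorm U 3 t ≤ β)
    {h : ℝ} (hh : 0 < h) :
    Integrable (diffQuotSource U h t) ∧
      ∫ x, |diffQuotSource U h t x| ≤
        (1 + 18 * (1 + B) ^ 2 + 4860 * B ^ 3 + 1944 * B ^ 2) * (1 + β) := by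
  have s := hU.cont_slice
  obtain ⟨iW, hW⟩ := hU.integrable_diffQuot_sq t hh
  obtain ⟨iρ, hρ⟩ := hU.integral_cubicTermDeriv_sq_le hB hβ
  obtain ⟨iD, hD⟩ := integral_sq_diffQuot_le (hU.cubicTerm_hasDerivAt t)
    (by unfold cubicTermDeriv; fun_prop) iρ hh
  have i3 : Integrable fun x => U 3 t (x + h) ^ 2 :=
    (hU.integrable_sq (le_refl 3) t).comp_add_right h
  have hB0 : 0 ≤ B := (add_nonneg (add_nonneg (sqNorm_nonneg U 0 t) (sqNorm_nonneg U 1 t))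
    (sqNorm_nonneg U 2 t)).trans hB
  have hK : ∀ x, |U 0 t x| ≤ 1 + B ∧ |U 1 t x| ≤ 1 + B := fun x => by
    obtain ⟨b0, b1⟩ := hU.slice_sq_le hB x
    constructor <;> refine abs_le_of_sq_le_sq ?_ (by linarith)
    all_goals nlinarith
  have hle : ∀ x, |diffQuotSource U h t x| ≤
      (12 * (1 + B) ^ 2 + 1) * diffQuot h (U 2) t x ^ 2
        + ((cubicTerm U t (x + h) - cubicTerm U t x) / h) ^ 2
        + 6 * (1 + B) ^ 2 * U 3 t (x + h) ^ 2 := by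
    intro x
    change _ ≤ _ + diffQuot h (cubicTerm U) t x ^ 2 + _
    have hA := hU.abs_diffQuot_zero_le hh (fun x => (hK x).2) x
    unfold diffQuotSource
    set W := diffQuot h (U 2) t x
    set D := diffQuot h (cubicTerm U) t x
    set d := U 3 t (x + h)
    have e1 : |U 0 t x * U 1 t x| ≤ (1 + B) ^ 2 := by
      rw [abs_mul, sq]; exact mul_le_mul (hK x).1 (hK x).2 (abs_nonneg _) (by linarith)
    have e2 : |(U 0 t (x + h) + U 0 t x) * diffQuot h (U 0) t x| ≤ 2 * (1 + B) ^ 2 := by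
      rw [abs_mul, sq, ← mul_assoc]
      refine mul_le_mul ((abs_add_le _ _).trans ?_) hA (abs_nonneg _) (by linarith)
      linarith [(hK x).1, (hK (x + h)).1]
    have e3 : |W * d| ≤ (W ^ 2 + d ^ 2) / 2 := by
      rw [_root_.abs_le]; constructor <;> nlinarith [sq_nonneg (W + d), sq_nonneg (W - d)]
    have e4 : |W * D| ≤ (W ^ 2 + D ^ 2) / 2 := by
      rw [_root_.abs_le]; constructor <;> nlinarith [sq_nonneg (W + D), sq_nonneg (W - D)]
    have f1 : |6 * U 0 t x * U 1 t x * W ^ 2| ≤ 6 * ((1 + B) ^ 2 * W ^ 2) := by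
      rw [mul_assoc 6, mul_assoc 6, abs_mul 6, abs_mul _ (W ^ 2), abs_of_nonneg (sq_nonneg W),
        abs_of_nonneg (by norm_num : (0 : ℝ) ≤ 6)]
      gcongr
    have f2 : |2 * W * D| ≤ W ^ 2 + D ^ 2 := by
      rw [mul_assoc, abs_mul, abs_of_nonneg (by norm_num : (0 : ℝ) ≤ 2)]; linarith
    have f3 : |6 * W * ((U 0 t (x + h) + U 0 t x) * diffQuot h (U 0) t x) * d| ≤
        6 * ((2 * (1 + B) ^ 2) * ((W ^ 2 + d ^ 2) / 2)) := by
      have : 6 * W * ((U 0 t (x + h) + U 0 t x) * diffQuot h (U 0) t x) * d =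
          6 * (((U 0 t (x + h) + U 0 t x) * diffQuot h (U 0) t x) * (W * d)) := by ring
      rw [this, abs_mul, abs_mul _ (W * d), abs_of_nonneg (by norm_num : (0 : ℝ) ≤ 6)]
      gcongr
    have t1 := abs_sub (6 * U 0 t x * U 1 t x * W ^ 2 - 2 * W * D)
      (6 * W * ((U 0 t (x + h) + U 0 t x) * diffQuot h (U 0) t x) * d)
    have t2 := abs_sub (6 * U 0 t x * U 1 t x * W ^ 2) (2 * W * D)
    linarith
  have k1 := iW.const_mul (12 * (1 + B) ^ 2 + 1)
  have k3 := i3.const_mul (6 * (1 + B) ^ 2)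
  have k2 : Integrable fun x => (12 * (1 + B) ^ 2 + 1) * diffQuot h (U 2) t x ^ 2
        + ((cubicTerm U t (x + h) - cubicTerm U t x) / h) ^ 2 := k1.add iD
  have k4 : Integrable fun x => (12 * (1 + B) ^ 2 + 1) * diffQuot h (U 2) t x ^ 2
        + ((cubicTerm U t (x + h) - cubicTerm U t x) / h) ^ 2
        + 6 * (1 + B) ^ 2 * U 3 t (x + h) ^ 2 := k2.add k3
  have m : Integrable (diffQuotSource U h t) :=
    k4.mono' (by unfold diffQuotSource cubicTerm diffQuot; fun_prop) (ae_of_all _ hle)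
  refine ⟨m, (integral_mono m.abs k4 hle).trans ?_⟩
  rw [integral_add k2 k3, integral_add k1 iD, integral_const_mul, integral_const_mul,
    integral_add_right_eq_self fun x => U 3 t x ^ 2]
  change _ + _ * sqNorm U 3 t ≤ _
  have l1 : (12 * (1 + B) ^ 2 + 1) * (∫ x, diffQuot h (U 2) t x ^ 2) ≤
      (12 * (1 + B) ^ 2 + 1) * β := mul_le_mul_of_nonneg_left (hW.trans hβ) (by positivity)
  have l2 : 6 * (1 + B) ^ 2 * sqNorm U 3 t ≤ 6 * (1 + B) ^ 2 * β :=
    mul_le_mul_of_nonneg_left hβ (by positivity)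
  have l3 : 0 ≤ (1 + B) ^ 2 := by positivity
  linarith [hD.trans hρ]

lemma tendsto_integral_diffQuot_sq (t : ℝ) :
    Tendsto (fun n : ℕ => ∫ x, diffQuot (1 / ((n : ℝ) + 1)) (U 2) t x ^ 2) atTop
      (𝓝 (sqNorm U 3 t)) := by
  have s := hU.cont_slice
  obtain ⟨C, hC⟩ := hU.decay t 3 le_rfl
  have hC0 : 0 ≤ C := by
    have := (abs_nonneg _).trans (hC 0)
    simpa using this
  have hpos : ∀ n : ℕ, 0 < 1 / ((n : ℝ) + 1) := fun n => by positivity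
  refine tendsto_integral_of_dominated_convergence (fun x => (3 * C) ^ 2 * (1 + x ^ 2)⁻¹)
    (fun n => (by unfold diffQuot; fun_prop : Continuous fun x =>
      diffQuot (1 / ((n : ℝ) + 1)) (U 2) t x ^ 2).aestronglyMeasurable)
    (integrable_inv_one_add_sq.const_mul _) (fun n => ae_of_all _ fun x => ?_)
    (ae_of_all _ fun x => ?_)
  · have h1 : 1 / ((n : ℝ) + 1) ≤ 1 := by
      rw [div_le_one (by positivity)]; linarith [(Nat.cast_nonneg n : (0 : ℝ) ≤ n)]
    set h := 1 / ((n : ℝ) + 1)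
    have hh : 0 < h := hpos n
    have hx0 : 0 < 1 + x ^ 2 := by positivity
    have hb : |diffQuot h (U 2) t x| ≤ 3 * C * (1 + x ^ 2)⁻¹ := by
      have hder : ∀ y ∈ Set.Icc x (x + h), ‖U 3 t y‖ ≤ 3 * C * (1 + x ^ 2)⁻¹ := by
        intro y hy
        refine (hC y).trans ?_
        rw [mul_comm 3 C, mul_assoc]
        gcongr
        rw [← div_eq_mul_inv, inv_eq_one_div, div_le_div_iff₀ (by positivity) hx0]
        have h3 : (y - x) ^ 2 ≤ 1 := by
          rw [sq_le_one_iff_abs_le_one, _root_.abs_le]; constructor <;> linarith [hy.1, hy.2]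
        nlinarith [sq_nonneg (2 * y - x)]
      have := (convex_Icc x (x + h)).norm_image_sub_le_of_norm_hasDerivWithin_le
        (fun y _ => (hU.dx 2 t y).hasDerivWithinAt) hder
        (Set.left_mem_Icc.2 (by linarith)) (Set.right_mem_Icc.2 (by linarith))
      rw [add_sub_cancel_left, Real.norm_eq_abs, Real.norm_eq_abs, abs_of_pos hh] at this
      rw [diffQuot, abs_div, abs_of_pos hh, div_le_iff₀ hh]
      exact this
    rw [norm_pow, Real.norm_eq_abs]
    have hi1 : (1 + x ^ 2)⁻¹ ≤ 1 := inv_le_one_of_one_le₀ (by nlinarith [sq_nonneg x])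
    calc |diffQuot h (U 2) t x| ^ 2 ≤ (3 * C * (1 + x ^ 2)⁻¹) ^ 2 := by gcongr
      _ = (3 * C) ^ 2 * ((1 + x ^ 2)⁻¹ * (1 + x ^ 2)⁻¹) := by ring
      _ ≤ (3 * C) ^ 2 * (1 * (1 + x ^ 2)⁻¹) := by gcongr
      _ = _ := by ring
  · have h0 : Tendsto (fun n : ℕ => 1 / ((n : ℝ) + 1)) atTop (𝓝[≠] 0) :=
      tendsto_nhdsWithin_iff.2 ⟨tendsto_one_div_add_atTop_nhds_zero_nat,
        Eventually.of_forall fun n => (hpos n).ne'⟩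
    have h1 := ((hU.dx 2 t x).tendsto_slope_zero.comp h0).pow 2
    refine h1.congr fun n => ?_
    simp only [Function.comp_apply, smul_eq_mul, diffQuot]
    rw [div_eq_inv_mul (U 2 t _ - U 2 t x)]

/-- As long as the `H²` norm is bounded, the third derivative varies in a Lipschitz way, with
constant affine in a bound of its squared norm. -/
lemma abs_sqNorm_three_sub_le {J : Set ℝ} (hJ : Convex ℝ J) {B β : ℝ}
    (hB : ∀ τ ∈ J, lowSq U τ ≤ B) (hβ : ∀ τ ∈ J, sqNorm U 3 τ ≤ β) {a s : ℝ} (ha : a ∈ J)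
    (hs : s ∈ J) :
    |sqNorm U 3 a - sqNorm U 3 s| ≤
      (1 + 18 * (1 + B) ^ 2 + 4860 * B ^ 3 + 1944 * B ^ 2) * (1 + β) * |a - s| := by
  have c := hU.cont_slice
  refine le_of_tendsto' (((hU.tendsto_integral_diffQuot_sq a).sub
    (hU.tendsto_integral_diffQuot_sq s)).abs) fun n => ?_
  set h := 1 / ((n : ℝ) + 1)
  have hh : 0 < h := by positivity
  have iW := fun τ => (hU.integrable_diffQuot_sq τ hh).1
  have iW' := fun τ => (hU.integrable_diffQuot_three_sq τ h).1
  have hm : ∀ τ B, lowSq U τ ≤ B → ∀ x,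
      3 * U 0 τ x ^ 2 * diffQuot h (U 2) τ x ^ 2 ≤ 3 * B * diffQuot h (U 2) τ x ^ 2 :=
    fun τ B hB x => by gcongr; exact (hU.slice_sq_le hB x).1
  have hm0 : ∀ τ x, 0 ≤ 3 * U 0 τ x ^ 2 * diffQuot h (U 2) τ x ^ 2 := fun τ x => by positivity
  have im : ∀ τ, Integrable fun x => 3 * U 0 τ x ^ 2 * diffQuot h (U 2) τ x ^ 2 := fun τ =>
    ((iW τ).const_mul (3 * lowSq U τ)).mono' (by unfold diffQuot; fun_prop)
      (ae_of_all _ fun x => by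
        rw [Real.norm_eq_abs, abs_of_nonneg (hm0 τ x)]; exact hm τ _ le_rfl x)
  have hB0 : 0 ≤ B := (add_nonneg (add_nonneg (sqNorm_nonneg U 0 a) (sqNorm_nonneg U 1 a))
    (sqNorm_nonneg U 2 a)).trans (hB a ha)
  have hβ0 : 0 ≤ β := (sqNorm_nonneg U 3 a).trans (hβ a ha)
  have hWβ : ∀ τ ∈ J, ∫ x, diffQuot h (U 2) τ x ^ 2 ≤ β := fun τ hτ =>
    (hU.integrable_diffQuot_sq τ hh).2.trans (hβ τ hτ)
  have hP : ∀ τ ∈ J, ∫ x, |-3 * diffQuot h (U 3) τ x ^ 2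
      + 3 * U 0 τ x ^ 2 * diffQuot h (U 2) τ x ^ 2| ≤ 3 * (4 / h ^ 2 * β) + 3 * B * β := by
    intro τ hτ
    calc _ ≤ ∫ x, (3 * diffQuot h (U 3) τ x ^ 2 + 3 * B * diffQuot h (U 2) τ x ^ 2) := by
          refine integral_mono (((iW' τ).const_mul (-3)).add (im τ)).abs
            (((iW' τ).const_mul 3).add ((iW τ).const_mul (3 * B))) fun x => ?_
          have h1 := hm τ B (hB τ hτ) x
          have h2 := hm0 τ x
          have h3 := sq_nonneg (diffQuot h (U 3) τ x)
          simp only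
          rw [_root_.abs_le]; constructor <;> linarith
      _ = 3 * (∫ x, diffQuot h (U 3) τ x ^ 2) + 3 * B * ∫ x, diffQuot h (U 2) τ x ^ 2 := by
          rw [integral_add ((iW' τ).const_mul 3) ((iW τ).const_mul (3 * B)), integral_const_mul,
            integral_const_mul]
      _ ≤ _ := by
          gcongr
          · refine (hU.integrable_diffQuot_three_sq τ h).2.trans ?_
            gcongr
            exact hβ τ hτ
          · exact hWβ τ hτ
  refine (hU.balanceLaw_diffQuot h).abs_integral_sub_le iW
    (fun τ => (hU.integral_abs_diffQuotSource_le le_rfl le_rfl hh).1)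
    (fun τ => ((iW' τ).const_mul (-3)).add (im τ)) (fun _ => integrable_zero _ _ _) iW hJ
    (B := 3 * (4 / h ^ 2 * β) + 3 * B * β + β)
    (fun τ hτ => (hU.integral_abs_diffQuotSource_le (hB τ hτ) (hβ τ hτ) hh).2)
    (fun τ hτ => (hP τ hτ).trans (by linarith)) (fun τ hτ => ?_) (fun τ hτ => ?_) ha hs
  · simp only [abs_zero, integral_zero]; positivity
  · simp only [abs_pow, sq_abs]
    have : 0 ≤ 3 * (4 / h ^ 2 * β) + 3 * B * β := by positivity
    linarith [hWβ τ hτ]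

end MKdVJet

/-- The Lipschitz constant in `MKdVJet.abs_sqNorm_three_sub_le`. -/
noncomputable def lipBound (B : ℝ) : ℝ :=
  1 + 18 * (1 + B) ^ 2 + 4860 * B ^ 3 + 1944 * B ^ 2

lemma one_le_lipBound {B : ℝ} (hB : 0 ≤ B) : 1 ≤ lipBound B := by
  unfold lipBound
  have : 0 ≤ 18 * (1 + B) ^ 2 + 4860 * B ^ 3 + 1944 * B ^ 2 := by positivity
  linarith

lemma lowSq_nonneg (U : ℕ → ℝ → ℝ → ℝ) (t : ℝ) : 0 ≤ lowSq U t :=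
  add_nonneg (add_nonneg (sqNorm_nonneg U 0 t) (sqNorm_nonneg U 1 t)) (sqNorm_nonneg U 2 t)

lemma sobolevSq_nonneg (U : ℕ → ℝ → ℝ → ℝ) (t : ℝ) : 0 ≤ sobolevSq U t :=
  integral_nonneg fun _ => sobolevDensity_nonneg U _ _

/-- Local boundedness of the `H³` norm at the time `t`. -/
def LocBdd (U : ℕ → ℝ → ℝ → ℝ) (t : ℝ) : Prop := ∃ B, ∀ᶠ τ in 𝓝 t, sobolevSq U τ ≤ B

lemma exists_bound_of_locBdd {U : ℕ → ℝ → ℝ → ℝ} {K : Set ℝ} (hK : IsCompact K)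
    (h : ∀ τ ∈ K, LocBdd U τ) : ∃ B, ∀ τ ∈ K, sobolevSq U τ ≤ B := by
  refine hK.induction_on (p := fun S => ∃ B, ∀ τ ∈ S, sobolevSq U τ ≤ B) ⟨0, by simp⟩ ?_ ?_ ?_
  · rintro s t hst ⟨B, hB⟩
    exact ⟨B, fun τ hτ => hB τ (hst hτ)⟩
  · rintro s t ⟨B, hB⟩ ⟨B', hB'⟩
    refine ⟨max B B', fun τ hτ => ?_⟩
    rcases hτ with hτ | hτ
    · exact (hB τ hτ).trans (le_max_left _ _)
    · exact (hB' τ hτ).trans (le_max_right _ _)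
  · intro τ hτ
    obtain ⟨B, hB⟩ := h τ hτ
    exact ⟨_, mem_nhdsWithin_of_mem_nhds hB, B, fun τ' hτ' => hτ'⟩

namespace MKdVJet

variable {U : ℕ → ℝ → ℝ → ℝ} (hU : MKdVJet U)
include hU

lemma sobolevSq_eq_add (t : ℝ) : sobolevSq U t = lowSq U t + sqNorm U 3 t := hU.sobolevSq_eq t

lemma sqNorm_three_le {J : Set ℝ} (hJ : Convex ℝ J) {B B' δ : ℝ}
    (hB : ∀ τ ∈ J, lowSq U τ ≤ B) (hB' : ∀ τ ∈ J, sobolevSq U τ ≤ B') {b : ℝ} (hb : b ∈ J)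
    (hδ : ∀ τ ∈ J, |τ - b| ≤ δ) (hδ' : lipBound B * δ ≤ 1 / 2) {τ : ℝ} (hτ : τ ∈ J) :
    sqNorm U 3 τ ≤ 2 * sqNorm U 3 b + 1 := by
  have hB0 : 0 ≤ B := (lowSq_nonneg U b).trans (hB b hb)
  have hL := one_le_lipBound hB0
  have hbdd : BddAbove (sqNorm U 3 '' J) := by
    refine ⟨B', ?_⟩
    rintro _ ⟨σ, hσ, rfl⟩
    linarith [hU.sobolevSq_eq_add σ, lowSq_nonneg U σ, hB' σ hσ]
  set β := sSup (sqNorm U 3 '' J)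
  have hβ : ∀ σ ∈ J, sqNorm U 3 σ ≤ β := fun σ hσ => le_csSup hbdd ⟨σ, hσ, rfl⟩
  have hβ0 : 0 ≤ β := (sqNorm_nonneg U 3 b).trans (hβ b hb)
  have key : β ≤ sqNorm U 3 b + 1 / 2 * (1 + β) := by
    refine csSup_le ⟨_, b, hb, rfl⟩ ?_
    rintro _ ⟨σ, hσ, rfl⟩
    have h := hU.abs_sqNorm_three_sub_le hJ hB hβ hσ hb
    change _ ≤ lipBound B * (1 + β) * |σ - b| at h
    have h1 : lipBound B * (1 + β) * |σ - b| ≤ 1 / 2 * (1 + β) := by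
      calc _ = lipBound B * |σ - b| * (1 + β) := by ring
        _ ≤ lipBound B * δ * (1 + β) := by gcongr; exact hδ σ hσ
        _ ≤ _ := by gcongr
    linarith [le_abs_self (sqNorm U 3 σ - sqNorm U 3 b)]
  linarith [hβ τ hτ]

lemma sobolevSq_le_of_locBdd {a s n : ℝ} (has : a ≠ s) (ha : sobolevSq U a ≤ n)
    (hl : lipBound (lowBound n) * |s - a| ≤ 1 / 2)
    (hloc : ∀ τ ∈ Set.uIcc a s, τ ≠ a → LocBdd U τ) :
    sobolevSq U s ≤ lowBound n + (2 * n + 1) := by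
  have hsub : ∀ τ ∈ Set.uIcc a s, τ ≠ a → ∀ σ ∈ Set.uIcc τ s, σ ∈ Set.uIcc a s ∧ σ ≠ a := by
    intro τ hτ hne σ hσ
    have hlt := lt_or_gt_of_ne has
    have hlt' := lt_or_gt_of_ne hne
    rw [Set.mem_uIcc] at *
    refine ⟨?_, ?_⟩
    · rcases hlt with h | h
      · left; constructor <;> rcases hτ with hτ | hτ <;> rcases hσ with hσ | hσ <;> linarith
      · right; constructor <;> rcases hτ with hτ | hτ <;> rcases hσ with hσ | hσ <;> linarith
    · rintro rfl
      rcases hlt with h | h <;> rcases hlt' with h' | h' <;> rcases hτ with hτ | hτ <;>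
        rcases hσ with hσ | hσ <;> linarith
  have hbd : ∀ τ ∈ Set.uIcc a s, τ ≠ a → ∃ B, ∀ σ ∈ Set.uIcc τ s, sobolevSq U σ ≤ B :=
    fun τ hτ hne => exists_bound_of_locBdd isCompact_uIcc fun σ hσ =>
      hloc σ (hsub τ hτ hne σ hσ).1 (hsub τ hτ hne σ hσ).2
  set B₁ := lowBound (lowSq U s) with hB₁
  have hlow : ∀ τ ∈ Set.uIcc a s, τ ≠ a → lowSq U τ ≤ B₁ := by
    intro τ hτ hne
    obtain ⟨B, hB⟩ := hbd τ hτ hne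
    exact hU.lowSq_le (convex_uIcc τ s) hB Set.right_mem_uIcc Set.left_mem_uIcc le_rfl
  have hB₁0 : 0 ≤ B₁ := (lowSq_nonneg U s).trans (hlow s Set.right_mem_uIcc has.symm)
  have hC₁ := one_le_lipBound hB₁0
  obtain ⟨b, hb, hba, hbl⟩ : ∃ b ∈ Set.uIcc a s, b ≠ a ∧ lipBound B₁ * |b - a| ≤ 1 / 2 := by
    set D := 1 + 2 * (lipBound B₁ * |s - a|) with hD
    have h0 : 0 ≤ lipBound B₁ * |s - a| := by positivity
    have hD1 : 1 ≤ D := by linarith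
    have hD0 : 0 < D := by linarith
    refine ⟨a + D⁻¹ * (s - a), ?_, ?_, ?_⟩
    · have h1 : D⁻¹ ≤ 1 := inv_le_one_of_one_le₀ hD1
      have h2 : 0 ≤ D⁻¹ := by positivity
      rw [Set.mem_uIcc]
      rcases le_total a s with h | h
      · left; constructor <;> nlinarith
      · right; constructor <;> nlinarith
    · have : D⁻¹ * (s - a) ≠ 0 := mul_ne_zero (inv_ne_zero hD0.ne') (sub_ne_zero.2 has.symm)
      intro h; apply this; linarith
    · rw [add_sub_cancel_left, abs_mul, abs_of_pos (inv_pos.2 hD0), mul_left_comm,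
        inv_mul_le_iff₀ hD0]
      linarith
  obtain ⟨B₂, hB₂⟩ := hbd b hb hba
  have hall : ∃ B, ∀ τ ∈ Set.uIcc a s, sobolevSq U τ ≤ B := by
    refine ⟨max n (max B₂ (B₁ + (2 * sqNorm U 3 b + 1))), fun τ hτ => ?_⟩
    rcases eq_or_ne τ a with rfl | hne
    · exact ha.trans (le_max_left _ _)
    rcases Set.uIcc_subset_uIcc_union_uIcc (b := b) hτ with h | h
    · have hsub' : Set.uIcc τ b ⊆ Set.uIcc τ s ∪ Set.uIcc b s := by
        rw [Set.uIcc_comm b s]; exact Set.uIcc_subset_uIcc_union_uIcc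
      have hmem : ∀ σ ∈ Set.uIcc τ b, σ ∈ Set.uIcc a s ∧ σ ≠ a := fun σ hσ => by
        rcases hsub' hσ with h' | h'
        · exact hsub τ hτ hne σ h'
        · exact hsub b hb hba σ h'
      obtain ⟨B, hB⟩ := exists_bound_of_locBdd (U := U) (K := Set.uIcc τ b) isCompact_uIcc
        fun σ hσ => hloc σ (hmem σ hσ).1 (hmem σ hσ).2
      have h3 := hU.sqNorm_three_le (convex_uIcc τ b)
        (fun σ hσ => hlow σ (hmem σ hσ).1 (hmem σ hσ).2) hB Set.right_mem_uIcc
        (fun σ hσ => by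
          rw [abs_sub_comm σ b]
          exact Set.abs_sub_right_of_mem_uIcc (Set.uIcc_subset_uIcc h Set.right_mem_uIcc hσ))
        hbl (Set.left_mem_uIcc : τ ∈ Set.uIcc τ b)
      rw [hU.sobolevSq_eq_add]
      exact (add_le_add (hlow τ hτ hne) h3).trans ((le_max_right _ _).trans (le_max_right _ _))
    · exact (hB₂ τ h).trans ((le_max_left _ _).trans (le_max_right _ _))
  obtain ⟨B, hB⟩ := hall
  have han : lowSq U a ≤ n := by
    linarith [hU.sobolevSq_eq_add a, sqNorm_nonneg U 3 a]
  have h3n : sqNorm U 3 a ≤ n := by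
    linarith [hU.sobolevSq_eq_add a, lowSq_nonneg U a]
  have hΦ : ∀ τ ∈ Set.uIcc a s, lowSq U τ ≤ lowBound n := fun τ hτ =>
    hU.lowSq_le (convex_uIcc a s) hB Set.left_mem_uIcc hτ han
  have h3 := hU.sqNorm_three_le (convex_uIcc a s) hΦ hB Set.left_mem_uIcc
    (fun σ hσ => Set.abs_sub_left_of_mem_uIcc hσ) hl Set.right_mem_uIcc
  rw [hU.sobolevSq_eq_add]
  linarith [hΦ s Set.right_mem_uIcc]

lemma isClosed_sobolevSq_le (n : ℝ) : IsClosed {t | sobolevSq U t ≤ n} := by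
  have c := hU.cont
  have hc : ∀ A : ℕ, Continuous fun t => ∫ x in (-(A : ℝ))..A, sobolevDensity U t x := fun A =>
    intervalIntegral.continuous_parametric_intervalIntegral_of_continuous'
      (by unfold Function.uncurry sobolevDensity; fun_prop) _ _
  have : {t | sobolevSq U t ≤ n} =
      ⋂ A : ℕ, {t | ∫ x in (-(A : ℝ))..A, sobolevDensity U t x ≤ n} := by
    ext t
    simp only [Set.mem_ofPred_eq, Set.mem_iInter]
    have i := hU.integrable_sobolevDensity t
    constructor
    · intro h A
      rw [intervalIntegral.integral_of_le (by linarith [(Nat.cast_nonneg A : (0 : ℝ) ≤ A)])]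
      exact (setIntegral_le_integral i (ae_of_all _ (sobolevDensity_nonneg U t))).trans h
    · intro h
      exact le_of_tendsto' (intervalIntegral_tendsto_integral i
        (tendsto_neg_atTop_atBot.comp tendsto_natCast_atTop_atTop) tendsto_natCast_atTop_atTop) h
  rw [this]
  exact isClosed_iInter fun A => isClosed_le (hc A) continuous_const

/-- The `H³` norm is locally bounded in time. No uniformity in time is assumed, so that this relies
on Baire's theorem on the set of possible exceptional times. -/
theorem locBdd (t : ℝ) : LocBdd U t := by
  set K : Set ℝ := {t | ¬ LocBdd U t} with hKdef
  have hopen : IsOpen {t | LocBdd U t} := by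
    rw [isOpen_iff_eventually]
    rintro τ ⟨B, hB⟩
    exact (eventually_eventually_nhds.2 hB).mono fun σ hσ => ⟨B, hσ⟩
  have hK : IsClosed K := hopen.isClosed_compl
  suffices K = ∅ by
    by_contra h
    exact (Set.mem_empty_iff_false t).1 (this ▸ h)
  by_contra hne
  obtain ⟨t₀, ht₀⟩ := Set.nonempty_iff_ne_empty.2 hne
  have : CompleteSpace K := hK.completeSpace_coe
  have : Nonempty K := ⟨⟨t₀, ht₀⟩⟩
  obtain ⟨n, ⟨t₁, ht₁⟩, hmem⟩ := nonempty_interior_of_iUnion_of_closed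
    (f := fun n : ℕ => {τ : K | sobolevSq U τ ≤ n})
    (fun n => (hU.isClosed_sobolevSq_le n).preimage continuous_subtype_val)
    (Set.eq_univ_of_forall fun τ => Set.mem_iUnion.2 (exists_nat_ge (sobolevSq U τ)))
  rw [mem_interior_iff_mem_nhds, Metric.mem_nhds_iff] at hmem
  obtain ⟨ε, hε, hball⟩ := hmem
  have hn : ∀ τ ∈ K, |τ - t₁| < ε → sobolevSq U τ ≤ n := fun τ hτ h =>
    hball (show (⟨τ, hτ⟩ : K) ∈ Metric.ball ⟨t₁, ht₁⟩ ε from h)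
  have hn1 : sobolevSq U t₁ ≤ n := hn t₁ ht₁ (by simpa using hε)
  have hΦ0 : 0 ≤ lowBound n := by unfold lowBound; positivity
  have hL := one_le_lipBound hΦ0
  refine ht₁ ⟨lowBound n + (2 * n + 1), ?_⟩
  have hδ : 0 < min ε (1 / (2 * lipBound (lowBound n))) := lt_min hε (by positivity)
  filter_upwards [Metric.ball_mem_nhds t₁ hδ] with s hs
  rw [Metric.mem_ball, Real.dist_eq, lt_min_iff] at hs
  by_cases hsK : s ∈ K
  · have : (0 : ℝ) ≤ n := Nat.cast_nonneg n
    linarith [hn s hsK hs.1]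
  obtain ⟨a, ⟨haK, haI⟩, hmin⟩ := (isCompact_uIcc.inter_left hK).exists_isMinOn
    (s := K ∩ Set.uIcc t₁ s) ⟨t₁, ht₁, Set.left_mem_uIcc⟩
    (f := fun τ => |τ - s|) (by fun_prop)
  have hadist : |a - t₁| ≤ |s - t₁| := Set.abs_sub_left_of_mem_uIcc haI
  have hsa : |s - a| ≤ |s - t₁| := Set.abs_sub_right_of_mem_uIcc haI
  have has : a ≠ s := fun h => hsK (h ▸ haK)
  refine hU.sobolevSq_le_of_locBdd has (hn a haK (hadist.trans_lt hs.1)) ?_ fun τ hτ hτa => ?_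
  · have h1 := (hsa.trans_lt hs.2).le
    rw [le_div_iff₀ (by positivity)] at h1
    linarith
  · by_contra hbad
    have hτI : τ ∈ Set.uIcc t₁ s := Set.uIcc_subset_uIcc haI Set.right_mem_uIcc hτ
    have h1 : |a - s| ≤ |τ - s| := hmin ⟨hbad, hτI⟩
    rw [Set.mem_uIcc] at hτ
    apply hτa
    rcases hτ with h | h
    · rw [abs_sub_comm, abs_sub_comm τ, abs_of_nonneg (by linarith), abs_of_nonneg (by linarith)]
        at h1
      linarith
    · rw [abs_of_nonneg (by linarith), abs_of_nonneg (by linarith)] at h1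
      linarith

end MKdVJet

lemma tendsto_integral_of_tendsto_integral_abs_sub {P : ℝ → ℝ → ℝ} {t : ℝ}
    (hP : ∀ τ, Integrable (P τ))
    (h : Tendsto (fun τ => ∫ x, |P τ x - P t x|) (𝓝 t) (𝓝 0)) :
    Tendsto (fun τ => ∫ x, P τ x) (𝓝 t) (𝓝 (∫ x, P t x)) := by
  rw [tendsto_iff_norm_sub_tendsto_zero]
  refine squeeze_zero (fun _ => norm_nonneg _) (fun τ => ?_) h
  rw [← integral_sub (hP τ) (hP t)]
  exact norm_integral_le_integral_norm _

namespace MKdVJet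

variable {U : ℕ → ℝ → ℝ → ℝ} (hU : MKdVJet U)
include hU

lemma tendsto_sqNorm_zero (t : ℝ) : Tendsto (sqNorm U 0) (𝓝 t) (𝓝 (sqNorm U 0 t)) := by
  obtain ⟨B, hB⟩ := hU.locBdd t
  obtain ⟨ε, hε, hball⟩ := Metric.eventually_nhds_iff_ball.1 hB
  refine tendsto_const_nhds.congr' ?_
  filter_upwards [Metric.ball_mem_nhds t hε] with τ hτ
  exact hU.mass_eq (convex_ball t ε) hball hτ (Metric.mem_ball_self hε)

lemma tendsto_integral_pow_mul_pow {i j : ℕ} (hi : 2 ≤ i) (t : ℝ) :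
    Tendsto (fun τ => ∫ x, U 0 τ x ^ i * U 1 τ x ^ j) (𝓝 t)
      (𝓝 (∫ x, U 0 t x ^ i * U 1 t x ^ j)) := by
  obtain ⟨B, hB⟩ := hU.locBdd t
  have hB0 : 0 ≤ B := (sobolevSq_nonneg U t).trans hB.self_of_nhds
  have c := hU.cont_time
  have hP : ∀ τ, Integrable fun x => U 0 τ x ^ i * U 1 τ x ^ j := fun τ => by
    simpa using hU.integrable_monomial i j 0 (by omega) τ
  refine tendsto_integral_of_tendsto_integral_abs_sub hP
    (tendsto_integral_abs_sub_of_dominated (S := fun τ x => U 0 τ x ^ 2)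
      (C := (1 + B) ^ (i - 2) * (1 + B) ^ j) (by positivity)
      (hU.integrable_sq (by norm_num)) (fun _ _ => sq_nonneg _)
      (fun x => ((c 0 x).pow 2).tendsto t) (hU.tendsto_sqNorm_zero t) hP
      (fun x => (((c 0 x).pow i).mul ((c 1 x).pow j)).tendsto t) ?_)
  filter_upwards [hB] with τ hτ x
  have h0 := (hU.abs_le (by norm_num : 0 ≤ 2) τ x).trans (add_le_add_right hτ 1)
  have h1 := (hU.abs_le (by norm_num : 1 ≤ 2) τ x).trans (add_le_add_right hτ 1)
  calc |U 0 τ x ^ i * U 1 τ x ^ j| = |U 0 τ x| ^ (i - 2) * |U 1 τ x| ^ j * U 0 τ x ^ 2 := by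
        rw [abs_mul, abs_pow, abs_pow, ← sq_abs (U 0 τ x), mul_right_comm, ← pow_add,
          Nat.sub_add_cancel hi]
    _ ≤ _ := by gcongr

lemma tendsto_sqNorm_one (t : ℝ) : Tendsto (sqNorm U 1) (𝓝 t) (𝓝 (sqNorm U 1 t)) := by
  obtain ⟨B, hB⟩ := hU.locBdd t
  obtain ⟨ε, hε, hball⟩ := Metric.eventually_nhds_iff_ball.1 hB
  have h4 := hU.tendsto_integral_pow_mul_pow (i := 4) (j := 0) (by norm_num) t
  simp only [pow_zero, mul_one] at h4
  have h := ((h4.sub_const (∫ x, U 0 t x ^ 4)).const_mul (1 / 2)).const_add (sqNorm U 1 t)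
  rw [sub_self, mul_zero, add_zero] at h
  refine h.congr' ?_
  filter_upwards [Metric.ball_mem_nhds t hε] with τ hτ
  linarith [hU.energy_eq (convex_ball t ε) hball hτ (Metric.mem_ball_self hε)]

lemma tendsto_sqNorm_two (t : ℝ) : Tendsto (sqNorm U 2) (𝓝 t) (𝓝 (sqNorm U 2 t)) := by
  obtain ⟨B, hB⟩ := hU.locBdd t
  obtain ⟨ε, hε, hball⟩ := Metric.eventually_nhds_iff_ball.1 hB
  have h22 := hU.tendsto_integral_pow_mul_pow (i := 2) (j := 2) (by norm_num) t
  have h6 := hU.tendsto_integral_pow_mul_pow (i := 6) (j := 0) (by norm_num) t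
  simp only [pow_zero, mul_one] at h6
  have h := (((h22.sub_const (∫ x, U 0 t x ^ 2 * U 1 t x ^ 2)).const_mul 5).sub
    ((h6.sub_const (∫ x, U 0 t x ^ 6)).const_mul (1 / 2))).const_add (sqNorm U 2 t)
  rw [sub_self, sub_self, mul_zero, mul_zero, sub_zero, add_zero] at h
  refine h.congr' ?_
  filter_upwards [Metric.ball_mem_nhds t hε] with τ hτ
  linarith [hU.second_eq (convex_ball t ε) hball hτ (Metric.mem_ball_self hε)]

lemma tendsto_sqNorm_three (t : ℝ) : Tendsto (sqNorm U 3) (𝓝 t) (𝓝 (sqNorm U 3 t)) := by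
  obtain ⟨B, hB⟩ := hU.locBdd t
  obtain ⟨ε, hε, hball⟩ := Metric.eventually_nhds_iff_ball.1 hB
  rw [tendsto_iff_norm_sub_tendsto_zero]
  have h : Tendsto (fun τ => lipBound B * (1 + B) * |τ - t|) (𝓝 t) (𝓝 0) := by
    have : Continuous fun τ => lipBound B * (1 + B) * |τ - t| := by fun_prop
    simpa using this.tendsto t
  refine squeeze_zero' (Eventually.of_forall fun _ => norm_nonneg _) ?_ h
  filter_upwards [Metric.ball_mem_nhds t hε] with τ hτ
  refine hU.abs_sqNorm_three_sub_le (convex_ball t ε) (fun σ hσ => ?_) (fun σ hσ => ?_) hτ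
    (Metric.mem_ball_self hε)
  · linarith [hU.sobolevSq_eq_add σ, sqNorm_nonneg U 3 σ, hball σ hσ]
  · linarith [hU.sobolevSq_eq_add σ, lowSq_nonneg U σ, hball σ hσ]

lemma tendsto_sobolevSq (t : ℝ) : Tendsto (sobolevSq U) (𝓝 t) (𝓝 (sobolevSq U t)) := by
  rw [hU.sobolevSq_eq t]
  exact ((((hU.tendsto_sqNorm_zero t).add (hU.tendsto_sqNorm_one t)).add
    (hU.tendsto_sqNorm_two t)).add (hU.tendsto_sqNorm_three t)).congr fun τ =>
      (hU.sobolevSq_eq τ).symm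

lemma tendsto_integral_abs_quadBdd_sub {F : ℝ → ℝ → ℝ → ℝ → ℝ} (hF : QuadBdd F)
    (hc : Continuous fun z : ℝ × ℝ => F (U 0 z.1 z.2) (U 1 z.1 z.2) (U 2 z.1 z.2) (U 3 z.1 z.2))
    (t : ℝ) :
    Tendsto (fun τ => ∫ x, |F (U 0 τ x) (U 1 τ x) (U 2 τ x) (U 3 τ x) -
      F (U 0 t x) (U 1 t x) (U 2 t x) (U 3 t x)|) (𝓝 t) (𝓝 0) := by
  obtain ⟨B, hB⟩ := hU.locBdd t
  obtain ⟨C, hC, h⟩ := hU.quadBdd_pointwise hF B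
  have c := hU.cont_time
  exact tendsto_integral_abs_sub_of_dominated
    (P := fun τ x => F (U 0 τ x) (U 1 τ x) (U 2 τ x) (U 3 τ x)) hC
    hU.integrable_sobolevDensity (sobolevDensity_nonneg U)
    (fun x => (by unfold sobolevDensity; fun_prop :
      Continuous fun τ => sobolevDensity U τ x).tendsto t) (hU.tendsto_sobolevSq t)
    (hU.integrable_quadBdd hF fun τ => hc.comp (by fun_prop : Continuous fun x : ℝ => (τ, x)))
    (fun x => (hc.comp (by fun_prop : Continuous fun τ : ℝ => (τ, x))).tendsto t)
    (hB.mono fun τ hτ => h τ hτ)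

theorem hasDerivAt_integral_secondDensity {f : ℕ → ℝ → ℝ} (hf : DerivTower f) {M : ℝ}
    (hM : ∀ k ≤ 3, ∀ x, |f k x| ≤ M) (t : ℝ) :
    HasDerivAt (fun s => ∫ x, secondDensity (U 0 s x) (U 1 s x) (U 2 s x) * f 0 x)
      ((∫ x, secondFlux (U 0 t x) (U 1 t x) (U 2 t x) (U 3 t x) * f 1 x)
        + (∫ x, 5 * (U 0 t x ^ 2 * U 1 t x * U 2 t x) * f 2 x)
        + ∫ x, 1 / 2 * U 2 t x ^ 2 * f 3 x) t := by
  have c := hU.cont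
  have s := hU.cont_slice
  have hQ : QuadBdd fun a b c _ => 5 * (a ^ 2 * b * c) := by
    simpa using (QuadBdd.monomial 2 1 1 (by norm_num)).const_mul 5
  have hR : QuadBdd fun _ _ c _ => 1 / 2 * c ^ 2 := by
    simpa using (QuadBdd.monomial 0 0 2 (by norm_num)).const_mul (1 / 2)
  exact hU.balanceLaw_second.hasDerivAt_integral
    (hU.integrable_quadBdd quadBdd_secondDensity fun τ => by unfold secondDensity; fun_prop)
    (hU.integrable_quadBdd quadBdd_secondFlux fun τ => by unfold secondFlux; fun_prop)
    (hU.integrable_quadBdd hQ fun τ => by fun_prop)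
    (hU.integrable_quadBdd hR fun τ => by fun_prop) hf hM
    (hU.tendsto_integral_abs_quadBdd_sub quadBdd_secondFlux (by unfold secondFlux; fun_prop) t)
    (hU.tendsto_integral_abs_quadBdd_sub hQ (by fun_prop) t)
    (hU.tendsto_integral_abs_quadBdd_sub hR (by fun_prop) t)

end MKdVJet

lemma hasDerivAt_slice_right {A : ℝ → ℝ → ℝ} (hA : Differentiable ℝ (Function.uncurry A))
    (t x : ℝ) : HasDerivAt (A t) (fderiv ℝ (Function.uncurry A) (t, x) (0, 1)) x :=
  ((hA (t, x)).hasFDerivAt.comp_hasDerivAt x ((hasDerivAt_const x t).prodMk (hasDerivAt_id x)))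

lemma hasDerivAt_slice_left {A : ℝ → ℝ → ℝ} (hA : Differentiable ℝ (Function.uncurry A))
    (t x : ℝ) : HasDerivAt (fun s => A s x) (fderiv ℝ (Function.uncurry A) (t, x) (1, 0)) t :=
  HasFDerivAt.comp_hasDerivAt (f := fun s : ℝ => (s, x)) t (hA (t, x)).hasFDerivAt
    ((hasDerivAt_id t).prodMk (hasDerivAt_const t x))

/-- Symmetry of mixed partial derivatives: if `∂ₓ A = B`, `∂ₜ A = Z` and `∂ₓ Z = Z'`, then
`∂ₜ B = Z'`. -/
lemma hasDerivAt_of_mixed_partials {A B Z Z' : ℝ → ℝ → ℝ}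
    (hA : ContDiff ℝ (⊤ : ℕ∞) (Function.uncurry A)) (hB : ∀ t x, HasDerivAt (A t) (B t x) x)
    (hZ : ∀ t x, HasDerivAt (fun s => A s x) (Z t x) t)
    (hZ' : ∀ t x, HasDerivAt (Z t) (Z' t x) x) (t x : ℝ) :
    HasDerivAt (fun s => B s x) (Z' t x) t := by
  have hd : Differentiable ℝ (Function.uncurry A) := hA.differentiable (by simp)
  have hf : Differentiable ℝ (fderiv ℝ (Function.uncurry A)) :=
    (hA.fderiv_right (m := (⊤ : ℕ∞)) (by exact_mod_cast le_top)).differentiable (by simp)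
  have eB : ∀ s y, B s y = fderiv ℝ (Function.uncurry A) (s, y) (0, 1) := fun s y =>
    (hB s y).unique (hasDerivAt_slice_right hd s y)
  have eZ : ∀ s y, Z s y = fderiv ℝ (Function.uncurry A) (s, y) (1, 0) := fun s y =>
    (hZ s y).unique (hasDerivAt_slice_left hd s y)
  have h1 := (hf (t, x)).hasFDerivAt.comp_hasDerivAt t
    ((hasDerivAt_id t).prodMk (hasDerivAt_const t x))
  have h2 := (hf (t, x)).hasFDerivAt.comp_hasDerivAt x
    ((hasDerivAt_const x t).prodMk (hasDerivAt_id x))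
  have g1 := h1.clm_apply (hasDerivAt_const t ((0, 1) : ℝ × ℝ))
  have g2 := h2.clm_apply (hasDerivAt_const x ((1, 0) : ℝ × ℝ))
  have hsymm : IsSymmSndFDerivAt ℝ (Function.uncurry A) (t, x) :=
    hA.contDiffAt.isSymmSndFDerivAt (by
      rw [minSmoothness_of_isRCLikeNormedField]
      exact ENat.LEInfty.out)
  have e' : Z' t x = fderiv ℝ (fderiv ℝ (Function.uncurry A)) (t, x) (0, 1) (1, 0) := by
    refine (hZ' t x).unique ((g2.congr_deriv (by simp)).congr_of_eventuallyEq
      (Eventually.of_forall fun y => ?_))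
    simpa using eZ t y
  rw [e', hsymm.eq]
  refine (g1.congr_deriv (by simp)).congr_of_eventuallyEq (Eventually.of_forall fun s => ?_)
  simpa using eB s x

lemma contDiff_iteratedDeriv_slice {u : ℝ → ℝ → ℝ}
    (hu : ContDiff ℝ (⊤ : ℕ∞) (Function.uncurry u)) (k : ℕ) :
    ContDiff ℝ (⊤ : ℕ∞) (Function.uncurry fun t => iteratedDeriv k (u t)) := by
  induction k with
  | zero => simpa using hu
  | succ k ih =>
    have hd := hasDerivAt_slice_right (ih.differentiable (by simp))
    have h := (ih.fderiv_right (m := (⊤ : ℕ∞)) (by exact_mod_cast le_top)).clm_apply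
      (contDiff_const (c := ((0, 1) : ℝ × ℝ)))
    convert h using 1
    ext ⟨t, x⟩
    simp only [Function.uncurry_apply_pair, iteratedDeriv_succ]
    exact (hd t x).deriv

lemma mkdvJet_iteratedDeriv {u : ℝ → ℝ → ℝ} (hu : ContDiff ℝ (⊤ : ℕ∞) (Function.uncurry u))
    (hmkdv : ∀ t x : ℝ,
      deriv (fun s => u s x) t
        + deriv (fun y => deriv (deriv (u t)) y + (u t y) ^ 3) x = 0)
    (hdecay : ∀ t : ℝ, ∀ k : ℕ, k ≤ 4 → ∀ n : ℕ,
      ∃ C : ℝ, ∀ x : ℝ, |x| ^ n * |iteratedDeriv k (u t) x| ≤ C) :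
    MKdVJet fun k t x => iteratedDeriv k (u t) x := by
  set U : ℕ → ℝ → ℝ → ℝ := fun k t x => iteratedDeriv k (u t) x with hU
  have hsm : ∀ k, ContDiff ℝ (⊤ : ℕ∞) (Function.uncurry (U k)) :=
    contDiff_iteratedDeriv_slice hu
  have hdiff : ∀ k, Differentiable ℝ (Function.uncurry (U k)) := fun k =>
    (hsm k).differentiable (by simp)
  have dx : ∀ k t x, HasDerivAt (U k t) (U (k + 1) t x) x := fun k t x => by
    have h := (hasDerivAt_slice_right (hdiff k) t x).differentiableAt.hasDerivAt
    simp only [hU, iteratedDeriv_succ]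
    exact h
  have d0 : ∀ t x, HasDerivAt (U 0 t) (U 1 t x) x := dx 0
  have d1 : ∀ t x, HasDerivAt (U 1 t) (U 2 t x) x := dx 1
  have d2 : ∀ t x, HasDerivAt (U 2 t) (U 3 t x) x := dx 2
  have d3 : ∀ t x, HasDerivAt (U 3 t) (U 4 t x) x := dx 3
  have d4 : ∀ t x, HasDerivAt (U 4 t) (U 5 t x) x := dx 4
  have dt0 : ∀ t x, HasDerivAt (fun s => U 0 s x)
      (-(U 3 t x + 3 * U 0 t x ^ 2 * U 1 t x)) t := fun t x => by
    have h := (hasDerivAt_slice_left (hdiff 0) t x).differentiableAt.hasDerivAt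
    refine h.congr_deriv ?_
    have e2 : deriv (deriv (u t)) = U 2 t := by
      simp only [hU]
      rw [iteratedDeriv_succ, iteratedDeriv_one]
    have e0 : ∀ t, u t = U 0 t := fun t => by simp [hU]
    have h3 : HasDerivAt (fun y => deriv (deriv (u t)) y + (u t y) ^ 3)
        (U 3 t x + 3 * U 0 t x ^ 2 * U 1 t x) x := by
      rw [e2, e0]
      exact ((d2 t x).add ((d0 t x).pow 3)).congr_deriv (by push_cast; ring)
    have := hmkdv t x
    rw [h3.deriv] at this
    simp only [e0] at this
    linarith
  have dt1 : ∀ t x, HasDerivAt (fun s => U 1 s x)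
      (-(U 4 t x + 6 * U 0 t x * U 1 t x ^ 2 + 3 * U 0 t x ^ 2 * U 2 t x)) t :=
    hasDerivAt_of_mixed_partials (hsm 0) d0 dt0 fun t x =>
      ((d3 t x).add ((((d0 t x).pow 2).const_mul 3).mul (d1 t x))).neg.congr_deriv
        (by push_cast [Pi.mul_apply, Pi.pow_apply]; ring)
  have dt2 : ∀ t x, HasDerivAt (fun s => U 2 s x)
      (-(U 5 t x + 6 * U 1 t x ^ 3 + 18 * (U 0 t x * U 1 t x * U 2 t x)
        + 3 * (U 0 t x ^ 2 * U 3 t x))) t :=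
    hasDerivAt_of_mixed_partials (hsm 1) d1 dt1 fun t x =>
      (((d4 t x).add (((d0 t x).const_mul 6).mul ((d1 t x).pow 2))).add
        ((((d0 t x).pow 2).const_mul 3).mul (d2 t x))).neg.congr_deriv
        (by push_cast [Pi.mul_apply, Pi.pow_apply]; ring)
  refine ⟨fun k => (hsm k).continuous, dx, dt0, dt1, dt2, fun t k hk => ?_⟩
  obtain ⟨C₀, h₀⟩ := hdecay t k (by omega) 0
  obtain ⟨C₂, h₂⟩ := hdecay t k (by omega) 2
  refine ⟨C₀ + C₂, fun x => ?_⟩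
  rw [← div_eq_mul_inv, le_div_iff₀ (by positivity)]
  have a₀ := h₀ x
  have a₂ := h₂ x
  rw [pow_zero, one_mul] at a₀
  rw [sq_abs] at a₂
  change |iteratedDeriv k (u t) x| * (1 + x ^ 2) ≤ C₀ + C₂
  linarith

/-- Time derivative of the localized second conserved quantity: if `f` is `C³` and bounded
together with its first three derivatives, and `u` is a smooth classical solution of mKdV
(`u_t + (u_xx + u³)_x = 0`) which is Schwartz in `x` (together with its `x`-derivatives up to
order four) at each time, then
`(d/dt) ∫ [(1/2) u_xx² - (5/2) u² u_x² + (1/4) u⁶] f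
  = ∫ (-(3/2) u_xxx² + 9 u_xx² u² + 15 u_x² u u_xx + (9/16) u⁸ + (1/4) u_x⁴
      + (3/2) u_xx u⁵ - (45/4) u⁴ u_x²) f' + 5 ∫ u² u_x u_xx f'' + (1/2) ∫ u_xx² f'''`. -/
theorem localized_F_time_derivative
    (f : ℝ → ℝ) (hf : ContDiff ℝ 3 f)
    (hfbdd : ∀ k : ℕ, k ≤ 3 → ∃ C : ℝ, ∀ x : ℝ, |iteratedDeriv k f x| ≤ C)
    (u : ℝ → ℝ → ℝ) (hu : ContDiff ℝ (⊤ : ℕ∞) (Function.uncurry u))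
    (hmkdv : ∀ t x : ℝ,
      deriv (fun s => u s x) t
        + deriv (fun y => deriv (deriv (u t)) y + (u t y) ^ 3) x = 0)
    (hdecay : ∀ t : ℝ, ∀ k : ℕ, k ≤ 4 → ∀ n : ℕ,
      ∃ C : ℝ, ∀ x : ℝ, |x| ^ n * |iteratedDeriv k (u t) x| ≤ C) :
    ∀ t : ℝ,
      HasDerivAt
        (fun s => ∫ x : ℝ,
          ((1 / 2) * (deriv (deriv (u s)) x) ^ 2
            - (5 / 2) * (u s x) ^ 2 * (deriv (u s) x) ^ 2
            + (1 / 4) * (u s x) ^ 6) * f x)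
        ((∫ x : ℝ,
            (-(3 / 2) * (iteratedDeriv 3 (u t) x) ^ 2
              + 9 * (deriv (deriv (u t)) x) ^ 2 * (u t x) ^ 2
              + 15 * (deriv (u t) x) ^ 2 * (u t x) * (deriv (deriv (u t)) x)
              + (9 / 16) * (u t x) ^ 8
              + (1 / 4) * (deriv (u t) x) ^ 4
              + (3 / 2) * (deriv (deriv (u t)) x) * (u t x) ^ 5
              - (45 / 4) * (u t x) ^ 4 * (deriv (u t) x) ^ 2) * deriv f x)
          + 5 * (∫ x : ℝ,
              (u t x) ^ 2 * deriv (u t) x * deriv (deriv (u t)) x * iteratedDeriv 2 f x)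
          + (1 / 2) * ∫ x : ℝ, (deriv (deriv (u t)) x) ^ 2 * iteratedDeriv 3 f x) t := by
  intro t
  have hU := mkdvJet_iteratedDeriv hu hmkdv hdecay
  choose! C hC using hfbdd
  have hM : ∀ k ≤ 3, ∀ x, |iteratedDeriv k f x| ≤ max (max (C 0) (C 1)) (max (C 2) (C 3)) := by
    intro k hk x
    refine (hC k hk x).trans ?_
    interval_cases k <;> simp
  have h := hU.hasDerivAt_integral_secondDensity (derivTower_iteratedDeriv hf) hM t
  have e2 : ∀ s, iteratedDeriv 2 (u s) = deriv (deriv (u s)) := fun s => by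
    rw [iteratedDeriv_succ, iteratedDeriv_one]
  simp only [secondDensity, secondFlux, iteratedDeriv_zero, iteratedDeriv_one, e2] at h
  refine h.congr_deriv ?_
  rw [← integral_const_mul, ← integral_const_mul]
  simp only [mul_assoc]
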